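/- There exists an absolute constant c > 0 such that for every simple graph G on n ≥ 2 vertices with degree sequence d_1, …, d_n, cr(G) ≤ c · log n · (pcr(G) + Σ_{k=1}^n d_k²). -/

import Mathlib

open scoped BigOperators

/-- A drawing of a simple graph in the plane: vertices are distinct points, each edge is a
simple continuous curve joining its endpoints, not passing through any other vertex point;
two distinct edge curves share only finitely many points, and no three edge curves pass
through a common interior point. -/
structure Drawing {V : Type*} (G : SimpleGraph V) where
  pos : V → ℝ × ℝ
  pos_inj : Function.Injective pos
  curve : G.edgeSet → ℝ → ℝ × ℝ
  curve_cont : ∀ e, ContinuousOn (curve e) (Set.Icc 0 1)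
  curve_inj : ∀ e, Set.InjOn (curve e) (Set.Icc 0 1)
  curve_ends : ∀ e : G.edgeSet, ∃ u v : V, (e : Sym2 V) = s(u, v) ∧
    curve e 0 = pos u ∧ curve e 1 = pos v
  curve_avoid : ∀ (e : G.edgeSet), ∀ t ∈ Set.Ioo (0:ℝ) 1, curve e t ∉ Set.range pos
  curve_finite_inter : ∀ e f : G.edgeSet, e ≠ f →
    (curve e '' Set.Icc 0 1 ∩ curve f '' Set.Icc 0 1).Finite
  no_triple_point : ∀ e f g : G.edgeSet, e ≠ f → f ≠ g → e ≠ g → ∀ p : ℝ × ℝ,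
    ¬ (p ∈ curve e '' Set.Ioo 0 1 ∧ p ∈ curve f '' Set.Ioo 0 1 ∧ p ∈ curve g '' Set.Ioo 0 1)

namespace Drawing

variable {V : Type*} {G : SimpleGraph V} (D : Drawing G)

/-- `p` is a crossing point of the edges `e` and `f`: a common interior point of their curves. -/
def IsCross (e f : G.edgeSet) (p : ℝ × ℝ) : Prop :=
  p ∈ D.curve e '' Set.Ioo 0 1 ∧ p ∈ D.curve f '' Set.Ioo 0 1

/-- The set of crossings of a drawing, recorded as (unordered pair of edges, crossing point). -/
def crossings : Set (Sym2 G.edgeSet × (ℝ × ℝ)) :=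
  { x | ∃ e f : G.edgeSet, e ≠ f ∧ x.1 = s(e, f) ∧ D.IsCross e f x.2 }

/-- The number of crossings of a drawing. -/
noncomputable def numCrossings : ℕ := D.crossings.ncard

/-- The set of unordered pairs of distinct edges that cross each other. -/
def crossingPairs : Set (Sym2 G.edgeSet) :=
  { q | ∃ e f : G.edgeSet, e ≠ f ∧ q = s(e, f) ∧ ∃ p, D.IsCross e f p }

/-- The number of pairs of edges that cross each other. -/
noncomputable def numCrossingPairs : ℕ := D.crossingPairs.ncard

/-- An edge participating in at least one crossing. -/
def CrossingEdge (e : G.edgeSet) : Prop :=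
  ∃ f : G.edgeSet, e ≠ f ∧ ∃ p, D.IsCross e f p

/-- A drawing is straight-line if every edge is the line segment between its endpoints. -/
def IsStraightLine : Prop :=
  ∀ (e : G.edgeSet), ∀ t ∈ Set.Icc (0:ℝ) 1,
    D.curve e t = D.curve e 0 + t • (D.curve e 1 - D.curve e 0)

/-- A convex drawing: the vertices are in convex position and edges are straight segments. -/
def IsConvex : Prop :=
  ConvexIndependent ℝ D.pos ∧ D.IsStraightLine

end Drawing

/-- The crossing number of a graph. -/
noncomputable def crNum {V : Type*} (G : SimpleGraph V) : ℕ :=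
  sInf { n | ∃ D : Drawing G, D.numCrossings = n }

/-- The pair crossing number of a graph. -/
noncomputable def pcrNum {V : Type*} (G : SimpleGraph V) : ℕ :=
  sInf { n | ∃ D : Drawing G, D.numCrossingPairs = n }

/-- The sum of the squares of the degrees of a graph. -/
noncomputable def ssqd {V : Type*} (G : SimpleGraph V) : ℕ :=
  ∑ᶠ v : V, ((G.neighborSet v).ncard) ^ 2

/-- The sum over all vertices of (degree choose 2). -/
noncomputable def bds {V : Type*} (G : SimpleGraph V) : ℕ :=
  ∑ᶠ v : V, ((G.neighborSet v).ncard).choose 2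


/-- lattice adjacency -/
def LAdj (p q : ℕ × ℕ) : Prop :=
  (q.1 = p.1 + 1 ∧ q.2 = p.2) ∨ (p.1 = q.1 + 1 ∧ p.2 = q.2) ∨
  (q.1 = p.1 ∧ q.2 = p.2 + 1) ∨ (p.1 = q.1 ∧ p.2 = q.2 + 1)

def chi (u x y : ℕ × ℕ) : ZMod 2 :=
  if x.2 = y.2 ∧ u.2 ≤ x.2 ∧ ((x.1 = u.1 ∧ y.1 = u.1 + 1) ∨ (y.1 = u.1 ∧ x.1 = u.1 + 1))
  then 1 else 0

def gpot (u u' x : ℕ × ℕ) : ZMod 2 :=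
  if u.2 = u'.2 ∧ x.1 = max u.1 u'.1 ∧ u.2 ≤ x.2 then 1 else 0

def c0 (N : ℕ) (x u : ℕ × ℕ) : ZMod 2 :=
  if x.2 = N ∧ x.1 < N ∧ u.1 < x.1 then 1 else 0

theorem zz (a : ZMod 2) : a + a = 0 := CharTwo.add_self_eq_zero a

theorem one_add_one_zmod : (1 : ZMod 2) + 1 = 0 := by decide

theorem LAdj.symm {p q : ℕ × ℕ} (h : LAdj p q) : LAdj q p := by
  unfold LAdj at *; omega

theorem chi_step {u u' x y : ℕ × ℕ} (h : LAdj u u') (hxy : LAdj x y)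
    (h1 : x ≠ u) (h2 : x ≠ u') (h3 : y ≠ u) (h4 : y ≠ u') :
    chi u x y + chi u' x y = gpot u u' x + gpot u u' y := by
  obtain ⟨i, j⟩ := u
  obtain ⟨i', j'⟩ := u'
  obtain ⟨a, b⟩ := x
  obtain ⟨a', b'⟩ := y
  simp only [LAdj, ne_eq, Prod.mk.injEq, chi, gpot] at *
  rcases h with ⟨rfl, rfl⟩ | ⟨rfl, rfl⟩ | ⟨rfl, rfl⟩ | ⟨rfl, rfl⟩ <;>
  rcases hxy with ⟨rfl, rfl⟩ | ⟨rfl, rfl⟩ | ⟨rfl, rfl⟩ | ⟨rfl, rfl⟩ <;>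
  split_ifs <;> first | (exfalso; omega) | simp [one_add_one_zmod]

theorem c0_step {N : ℕ} {u u' x : ℕ × ℕ} (h : LAdj u u')
    (hu : 0 < u.1 ∧ u.1 < N ∧ 0 < u.2 ∧ u.2 < N)
    (hu' : 0 < u'.1 ∧ u'.1 < N ∧ 0 < u'.2 ∧ u'.2 < N)
    (hx : x.1 ≤ N ∧ x.2 ≤ N) (hb : x.1 = 0 ∨ x.1 = N ∨ x.2 = 0 ∨ x.2 = N) :
    c0 N x u + c0 N x u' = gpot u u' x := by
  obtain ⟨i, j⟩ := u
  obtain ⟨i', j'⟩ := u'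
  obtain ⟨a, b⟩ := x
  simp only [LAdj, c0, gpot] at *
  rcases h with ⟨rfl, rfl⟩ | ⟨rfl, rfl⟩ | ⟨rfl, rfl⟩ | ⟨rfl, rfl⟩ <;>
  split_ifs <;> first | (exfalso; omega) | simp [one_add_one_zmod]

theorem chi_square {u : ℕ × ℕ} {a b : ℕ} (h1 : (a, b) ≠ u) (h2 : (a + 1, b) ≠ u)
    (h3 : (a, b + 1) ≠ u) (h4 : (a + 1, b + 1) ≠ u) :
    chi u (a, b) (a + 1, b) + chi u (a, b + 1) (a + 1, b + 1)
      + (chi u (a, b) (a, b + 1) + chi u (a + 1, b) (a + 1, b + 1)) = 0 := by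
  obtain ⟨i, j⟩ := u
  simp only [ne_eq, Prod.mk.injEq, chi, true_and] at *
  split_ifs <;> first | (exfalso; omega) | simp [one_add_one_zmod]

section Sep
variable {V : Type*} [DecidableEq V]

open Classical in
noncomputable def strAt (F : Finset (Sym2 V)) (Z : Sym2 V → Set (ℕ × ℕ)) (p : ℕ × ℕ) :
    Finset (Sym2 V) := F.filter (fun e => p ∈ Z e)

theorem strAt_sub (F : Finset (Sym2 V)) (Z : Sym2 V → Set (ℕ × ℕ)) (p : ℕ × ℕ) :
    strAt F Z p ⊆ F := by
  classical
  exact Finset.filter_subset _ _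

open Classical in
noncomputable def strN (F : Finset (Sym2 V)) (Z : Sym2 V → Set (ℕ × ℕ)) (e : Sym2 V) :
    Finset (Sym2 V) := F.filter (fun f => (Z e ∩ Z f).Nonempty)

inductive Rch (F : Finset (Sym2 V)) (Z : Sym2 V → Set (ℕ × ℕ)) (N : ℕ) :
    ℕ × ℕ → Finset (Sym2 V) → (ℕ × ℕ → ZMod 2) → Prop
  | base (x : ℕ × ℕ) (hx : x.1 ≤ N ∧ x.2 ≤ N) (hb : x.1 = 0 ∨ x.1 = N ∨ x.2 = 0 ∨ x.2 = N) :
      Rch F Z N x ∅ (c0 N x)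
  | step (x y : ℕ × ℕ) (T : Finset (Sym2 V)) (c : ℕ × ℕ → ZMod 2) (h : Rch F Z N x T c)
      (ha : LAdj x y) (hy : y.1 ≤ N ∧ y.2 ≤ N) :
      Rch F Z N y (T ∪ strAt F Z y) (fun u => c u + chi u x y)

structure LatSys (F : Finset (Sym2 V)) (Z : Sym2 V → Set (ℕ × ℕ)) (N : ℕ) (z : V → ℕ × ℕ) : Prop where
  box : ∀ e ∈ F, ∀ p ∈ Z e, 0 < p.1 ∧ p.1 < N ∧ 0 < p.2 ∧ p.2 < N
  conn : ∀ e ∈ F, ∀ p ∈ Z e, ∀ q ∈ Z e,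
    Relation.ReflTransGen (fun a b => LAdj a b ∧ a ∈ Z e ∧ b ∈ Z e) p q
  hz : ∀ e ∈ F, ∀ v ∈ e, z v ∈ Z e

variable {F : Finset (Sym2 V)} {Z : Sym2 V → Set (ℕ × ℕ)} {N : ℕ} {z : V → ℕ × ℕ}

theorem Rch.inv (L : LatSys F Z N z) {x T c} (h : Rch F Z N x T c) :
    (x.1 ≤ N ∧ x.2 ≤ N) ∧ strAt F Z x ⊆ T ∧ T ⊆ F ∧
    ∀ e ∈ F, e ∉ T → ∀ u ∈ Z e, ∀ u' ∈ Z e, LAdj u u' → c u + c u' = gpot u u' x := by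
  induction h with
  | base x hx hb =>
    refine ⟨hx, ?_, by simp, ?_⟩
    · intro e he
      simp only [strAt, Finset.mem_filter] at he
      have := L.box e he.1 x he.2
      omega
    · intro e he _ u hu u' hu' ha
      exact c0_step ha (L.box e he u hu) (L.box e he u' hu') hx hb
  | step x y T c h ha hy ih =>
    obtain ⟨i1, i2, i3, i4⟩ := ih
    refine ⟨hy, Finset.subset_union_right, ?_, ?_⟩
    · exact Finset.union_subset i3 (strAt_sub _ _ _)
    · intro e he hT u hu u' hu' hau
      simp only [Finset.mem_union, not_or] at hT
      have hx : x ∉ Z e := fun hx => hT.1 (i2 (by simp [strAt, he, hx]))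
      have hy' : y ∉ Z e := fun hx => hT.2 (by simp [strAt, he, hx])
      have e1 := i4 e he hT.1 u hu u' hu' hau
      have e2 := chi_step hau ha (fun h => hx (h ▸ hu)) (fun h => hx (h ▸ hu'))
        (fun h => hy' (h ▸ hu)) (fun h => hy' (h ▸ hu'))
      have : c u + chi u x y + (c u' + chi u' x y) = (c u + c u') + (chi u x y + chi u' x y) := by
        ring
      rw [this, e1, e2]
      have := zz (gpot u u' x)
      linear_combination this

theorem Rch.exists (x : ℕ × ℕ) (hx : x.1 ≤ N ∧ x.2 ≤ N) :
    ∃ T c, Rch F Z N x T c := by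
  obtain ⟨a, b⟩ := x
  induction a with
  | zero => exact ⟨_, _, Rch.base _ hx (Or.inl rfl)⟩
  | succ a ih =>
    obtain ⟨T, c, h⟩ := ih ⟨by have := hx.1; simp at *; omega, hx.2⟩
    exact ⟨_, _, Rch.step _ _ _ _ h (by simp [LAdj]) hx⟩

variable (F Z N) in
noncomputable def dd (x : ℕ × ℕ) : ℕ := sInf {k | ∃ T c, Rch F Z N x T c ∧ T.card = k}

theorem dd_le {x T c} (h : Rch F Z N x T c) : dd F Z N x ≤ T.card :=
  Nat.sInf_le ⟨T, c, h, rfl⟩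

theorem dd_spec (x : ℕ × ℕ) (hx : x.1 ≤ N ∧ x.2 ≤ N) :
    ∃ T c, Rch F Z N x T c ∧ T.card = dd F Z N x := by
  obtain ⟨T, c, h⟩ := Rch.exists (F := F) (Z := Z) x hx
  exact Nat.sInf_mem (s := {k | ∃ T c, Rch F Z N x T c ∧ T.card = k}) ⟨_, T, c, h, rfl⟩

theorem dd_str (L : LatSys F Z N z) {e} (he : e ∈ F) {x y} (hx : x ∈ Z e) (hy : y ∈ Z e) :
    dd F Z N y ≤ dd F Z N x + (strN F Z e).card := by
  have bx := L.box e he x hx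
  obtain ⟨T, c, h, hT⟩ := dd_spec (F := F) (Z := Z) x (N := N) (by omega)
  have key : ∃ T' c', Rch F Z N y T' c' ∧ T' ⊆ T ∪ strN F Z e := by
    have := L.conn e he x hx y hy
    clear hy
    induction this with
    | refl => exact ⟨T, c, h, Finset.subset_union_left⟩
    | tail _ hs ih =>
      rename_i p q _
      obtain ⟨T', c', h', hs'⟩ := ih
      have bq := L.box e he q hs.2.2
      refine ⟨_, _, Rch.step _ _ _ _ h' hs.1 (by omega), ?_⟩
      apply Finset.union_subset hs'
      refine subset_trans ?_ Finset.subset_union_right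
      intro f hf
      simp only [strAt, strN, Finset.mem_filter] at *
      exact ⟨hf.1, q, hs.2.2, hf.2⟩
  obtain ⟨T', c', h', hs⟩ := key
  calc dd F Z N y ≤ T'.card := dd_le h'
    _ ≤ (T ∪ strN F Z e).card := Finset.card_le_card hs
    _ ≤ _ := Finset.card_union_le _ _
    _ = _ := by rw [hT]

theorem strAt_card (p : ℕ × ℕ) {R : ℕ} (hR : ∑ e ∈ F, (strN F Z e).card ≤ R ^ 2) :
    (strAt F Z p).card ≤ R := by
  have h1 : ∀ e ∈ strAt F Z p, (strAt F Z p).card ≤ (strN F Z e).card := by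
    intro e he
    apply Finset.card_le_card
    intro f hf
    simp only [strAt, strN, Finset.mem_filter] at *
    exact ⟨hf.1, p, he.2, hf.2⟩
  have h2 : (strAt F Z p).card * (strAt F Z p).card ≤ R ^ 2 := by
    calc _ = ∑ e ∈ strAt F Z p, (strAt F Z p).card := by simp
      _ ≤ ∑ e ∈ strAt F Z p, (strN F Z e).card := Finset.sum_le_sum h1
      _ ≤ ∑ e ∈ F, (strN F Z e).card :=
        Finset.sum_le_sum_of_subset (strAt_sub _ _ _)
      _ ≤ _ := hR
  nlinarith

open Classical in
variable (F Z N) in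
/-- strings straddling a level -/
noncomputable def cutX (R τ : ℕ) : Finset (Sym2 V) :=
  F.filter (fun e => ∃ x ∈ Z e, ∃ y ∈ Z e, (dd F Z N x + τ) / R ≠ (dd F Z N y + τ) / R)

theorem cut_aux {a b R τ : ℕ} (hR : 0 < R) (hτ : τ < R) (h : (a + τ) / R < (b + τ) / R) :
    ∃ r ∈ Finset.Ioc a b, τ = (R - r % R) % R := by
  have h1 := Nat.div_add_mod (a + τ) R
  have h2 := Nat.div_add_mod (b + τ) R
  have h3 := Nat.mod_lt (a + τ) hR
  have h4 := Nat.mod_lt (b + τ) hR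
  set q := (b + τ) / R
  have h5 : R * ((a + τ) / R) + R ≤ R * q := by
    have : R * ((a + τ) / R + 1) ≤ R * q := Nat.mul_le_mul_left _ h
    linarith [this]
  refine ⟨R * q - τ, by simp; omega, ?_⟩
  have h6 : (R * q - τ + τ) % R = 0 := by
    rw [Nat.sub_add_cancel (by omega)]; simp
  set r := R * q - τ
  have h7 : (r % R + τ) % R = 0 := by rw [Nat.mod_add_mod]; exact h6
  have h8 := Nat.mod_lt r hR
  by_cases hr : r % R = 0
  · rw [hr] at h7 ⊢
    simp at h7 ⊢
    rw [Nat.mod_eq_of_lt hτ] at h7; exact h7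
  · have : r % R + τ = R := by
      have h9 : R ∣ r % R + τ := Nat.dvd_of_mod_eq_zero h7
      obtain ⟨k, hk⟩ := h9
      have : k = 1 := by
        have : k < 2 := by by_contra hh; have : R * 2 ≤ R * k := Nat.mul_le_mul_left _ (by omega)
                           omega
        rcases k with _ | _ | k
        · omega
        · rfl
        · omega
      subst this; omega
    rw [Nat.mod_eq_of_lt (by omega)]; omega

open Classical in
theorem exists_cut (L : LatSys F Z N z) {R : ℕ} (hR0 : 0 < R)
    (hR : ∑ e ∈ F, (strN F Z e).card ≤ R ^ 2) : ∃ τ < R, (cutX F Z N R τ).card ≤ R := by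
  by_contra hcon
  push Not at hcon
  have h1 : ∑ τ ∈ Finset.range R, (cutX F Z N R τ).card ≤ R ^ 2 := by
    have : ∑ τ ∈ Finset.range R, (cutX F Z N R τ).card
        = ∑ e ∈ F, ((Finset.range R).filter (fun τ => e ∈ cutX F Z N R τ)).card := by
      have h := Finset.sum_card_bipartiteAbove_eq_sum_card_bipartiteBelow
        (s := Finset.range R) (t := F) (fun τ e => e ∈ cutX F Z N R τ)
      rw [← Finset.sum_congr rfl, h]
      · rfl
      · intro τ _
        congr 1
        ext e
        simp [Finset.bipartiteAbove, cutX]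
    rw [this]
    refine le_trans (Finset.sum_le_sum ?_) hR
    intro e he
    by_cases hne : (Z e).Nonempty
    · obtain ⟨m, hm, hmin⟩ : ∃ m ∈ Z e, ∀ y ∈ Z e, dd F Z N m ≤ dd F Z N y := by
        obtain ⟨m, hm⟩ := (wellFounded_lt (α := ℕ)).has_min ((dd F Z N) '' Z e) (hne.image _)
        obtain ⟨⟨m', hm', rfl⟩, h2⟩ := hm
        exact ⟨m', hm', fun y hy => not_lt.mp (h2 _ ⟨y, hy, rfl⟩)⟩
      set ω := (strN F Z e).card
      have hsub : (Finset.range R).filter (fun τ => e ∈ cutX F Z N R τ) ⊆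
          (Finset.Ioc (dd F Z N m) (dd F Z N m + ω)).image (fun r => (R - r % R) % R) := by
        intro τ hτ
        simp only [Finset.mem_filter, Finset.mem_range, cutX] at hτ
        obtain ⟨hτ, _, x, hx, y, hy, hne⟩ := hτ
        have : ∃ y ∈ Z e, (dd F Z N m + τ) / R < (dd F Z N y + τ) / R := by
          have hx1 := Nat.div_le_div_right (c := R) (Nat.add_le_add_right (hmin x hx) τ)
          have hy1 := Nat.div_le_div_right (c := R) (Nat.add_le_add_right (hmin y hy) τ)
          rcases Nat.lt_or_gt_of_ne hne with h | h
          · exact ⟨y, hy, by omega⟩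
          · exact ⟨x, hx, by omega⟩
        obtain ⟨y, hy, hlt⟩ := this
        obtain ⟨r, hr, h⟩ := cut_aux hR0 hτ hlt
        have := dd_str L he hm hy
        simp only [Finset.mem_image, Finset.mem_Ioc] at hr ⊢
        exact ⟨r, ⟨hr.1, by omega⟩, h.symm⟩
      refine le_trans (Finset.card_le_card hsub) (le_trans Finset.card_image_le ?_)
      simp
    · rw [Finset.filter_false_of_mem]
      · simp
      · intro τ _ h
        simp only [cutX, Finset.mem_filter] at h
        obtain ⟨_, x, hx, _⟩ := h
        exact hne ⟨x, hx⟩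
  have h2 : ∑ τ ∈ Finset.range R, (R + 1) ≤ ∑ τ ∈ Finset.range R, (cutX F Z N R τ).card :=
    Finset.sum_le_sum (fun τ hτ => hcon τ (Finset.mem_range.mp hτ))
  simp at h2
  nlinarith

end Sep
set_option linter.unusedVariables false
set_option linter.unusedSimpArgs false
set_option linter.unusedSectionVars false
section Sep2
variable {V : Type*} [DecidableEq V]
variable {F : Finset (Sym2 V)} {Z : Sym2 V → Set (ℕ × ℕ)} {N : ℕ} {z : V → ℕ × ℕ}

open Classical in
variable (F Z N) in
noncomputable def bnd (R τ b0 : ℕ) : Finset (Sym2 V) :=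
  F.filter (fun e => ∀ p ∈ Z e, (dd F Z N p + τ) / R = b0)

theorem Rch.band {R τ b0 : ℕ} (hR0 : 0 < R)
    (hR : ∑ e ∈ F, (strN F Z e).card ≤ R ^ 2) {x T c} (h : Rch F Z N x T c) :
    T ∩ bnd F Z N R τ b0 = ∅ ∨ b0 * R ≤ (T \ bnd F Z N R τ b0).card + τ + R := by
  induction h with
  | base x hx hb => left; simp
  | step x y T c h ha hy ih =>
    set B := bnd F Z N R τ b0
    rcases ih with ih | ih
    · by_cases hyB : strAt F Z y ∩ B = ∅
      · left; rw [Finset.union_inter_distrib_right, ih, hyB]; simp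
      · right
        obtain ⟨e, he⟩ := Finset.nonempty_iff_ne_empty.mpr hyB
        simp only [Finset.mem_inter, strAt, Finset.mem_filter, B, bnd] at he
        have h1 := he.2.2 y he.1.2
        have h2 : b0 * R ≤ dd F Z N y + τ := by
          rw [← h1]; exact Nat.div_mul_le_self _ _
        have h3 := dd_le (Rch.step _ _ _ _ h ha hy)
        have h4 := Finset.card_union_le T (strAt F Z y)
        have h5 := strAt_card y hR
        have h6 : T ⊆ (T ∪ strAt F Z y) \ B := by
          intro f hf
          simp only [Finset.mem_sdiff, Finset.mem_union]
          refine ⟨Or.inl hf, fun hB => ?_⟩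
          have : f ∈ T ∩ B := Finset.mem_inter.mpr ⟨hf, hB⟩
          rw [ih] at this; simp at this
        have h7 := Finset.card_le_card h6
        omega
    · right
      have : T \ B ⊆ (T ∪ strAt F Z y) \ B :=
        Finset.sdiff_subset_sdiff Finset.subset_union_left le_rfl
      have := Finset.card_le_card this
      omega

theorem band_path {R τ b0 : ℕ} (hR0 : 0 < R)
    (hR : ∑ e ∈ F, (strN F Z e).card ≤ R ^ 2) (x : ℕ × ℕ) (hx : x.1 ≤ N ∧ x.2 ≤ N) :
    ∃ T c, Rch F Z N x T c ∧ (T ∩ bnd F Z N R τ b0).card ≤ 2 * R ∧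
      ((x.1 = 0 ∨ x.1 = N ∨ x.2 = 0 ∨ x.2 = N) → c = c0 N x) := by
  by_cases hb : x.1 = 0 ∨ x.1 = N ∨ x.2 = 0 ∨ x.2 = N
  · exact ⟨_, _, Rch.base x hx hb, by simp, fun _ => rfl⟩
  suffices h : ∃ T c, Rch F Z N x T c ∧ (T ∩ bnd F Z N R τ b0).card ≤ 2 * R by
    obtain ⟨T, c, h1, h2⟩ := h
    exact ⟨T, c, h1, h2, fun h => absurd h hb⟩
  clear hb
  obtain ⟨a, b⟩ := x
  induction a with
  | zero => exact ⟨_, _, Rch.base _ hx (Or.inl rfl), by simp⟩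
  | succ a ih =>
    by_cases hd : (dd F Z N (a + 1, b) + τ) / R ≤ b0
    · obtain ⟨T, c, h, hT⟩ := dd_spec (F := F) (Z := Z) (N := N) (a + 1, b) hx
      refine ⟨T, c, h, ?_⟩
      have h1 := Finset.card_inter_add_card_sdiff T (bnd F Z N R τ b0)
      have h2 : dd F Z N (a + 1, b) + τ < (b0 + 1) * R := by
        rw [← Nat.div_lt_iff_lt_mul hR0]; omega
      rcases h.band (τ := τ) (b0 := b0) hR0 hR with h3 | h3
      · rw [h3]; simp
      · have : (b0 + 1) * R = b0 * R + R := by ring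
        omega
    · obtain ⟨T, c, h, hT⟩ := ih ⟨by have := hx.1; simp at *; omega, hx.2⟩
      refine ⟨_, _, Rch.step _ _ _ _ h (by simp [LAdj]) hx, ?_⟩
      refine le_trans (Finset.card_le_card ?_) hT
      intro e he
      simp only [Finset.mem_inter, Finset.mem_union] at he ⊢
      refine ⟨?_, he.2⟩
      rcases he.1 with h1 | h1
      · exact h1
      · exfalso
        have h2 := he.2
        simp only [strAt, bnd, Finset.mem_filter] at h1 h2
        have := h2.2 _ h1.2
        omega

variable (F) in
def gX (X : Finset (Sym2 V)) : SimpleGraph V := SimpleGraph.fromEdgeSet (↑(F \ X) : Set (Sym2 V))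

theorem gX_adj {X : Finset (Sym2 V)} {u v : V} (h : (gX F X).Adj u v) :
    s(u, v) ∈ F ∧ s(u, v) ∉ X := by
  simp only [gX, SimpleGraph.fromEdgeSet_adj, Finset.coe_sdiff, Set.mem_sdiff, Finset.mem_coe] at h
  exact h.1

theorem gX_mono {X Y : Finset (Sym2 V)} (h : X ⊆ Y) : gX F Y ≤ gX F X := by
  unfold gX
  apply SimpleGraph.fromEdgeSet_mono
  intro e he
  simp only [Finset.coe_sdiff, Set.mem_sdiff, Finset.mem_coe] at he ⊢
  exact ⟨he.1, fun h' => he.2 (h h')⟩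

open Classical in
variable (F) in
noncomputable def cmpt [Fintype V] (X : Finset (Sym2 V)) (v : V) : Finset V :=
  Finset.univ.filter (fun u => (gX F X).Reachable v u)

theorem mem_cmp [Fintype V] {X : Finset (Sym2 V)} {v u : V} :
    u ∈ cmpt F X v ↔ (gX F X).Reachable v u := by simp [cmpt]

/-- heavy sets meet -/
theorem heavy4 [Fintype V] (w : V → ℕ) (A B C D : Finset V)
    (hA : 3 * ∑ v, w v < 4 * ∑ v ∈ A, w v) (hB : 3 * ∑ v, w v < 4 * ∑ v ∈ B, w v)
    (hC : 3 * ∑ v, w v < 4 * ∑ v ∈ C, w v) (hD : 3 * ∑ v, w v < 4 * ∑ v ∈ D, w v) :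
    ∃ v, v ∈ A ∧ v ∈ B ∧ v ∈ C ∧ v ∈ D := by
  by_contra hcon
  push Not at hcon
  have h : ∀ S : Finset V, ∑ v ∈ S, w v = ∑ v, if v ∈ S then w v else 0 := by
    intro S; simp
  rw [h A] at hA
  rw [h B] at hB
  rw [h C] at hC
  rw [h D] at hD
  have : ∑ v, ((if v ∈ A then w v else 0) + (if v ∈ B then w v else 0) +
      (if v ∈ C then w v else 0) + (if v ∈ D then w v else 0)) ≤ ∑ v, 3 * w v := by
    apply Finset.sum_le_sum
    intro v _
    have := hcon v
    by_cases h1 : v ∈ A <;> by_cases h2 : v ∈ B <;> by_cases h3 : v ∈ C <;> by_cases h4 : v ∈ D <;>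
      simp [h1, h2, h3, h4] at this ⊢ <;> omega
  rw [← Finset.mul_sum] at this
  simp only [Finset.sum_add_distrib] at this
  omega

theorem heavy_edge [Fintype V] (w : V → ℕ) (hw : ∀ v, 4 * w v ≤ 3 * ∑ v, w v)
    {X : Finset (Sym2 V)} {v u : V}
    (hA : 3 * ∑ v, w v < 4 * ∑ v ∈ cmpt F X v, w v) (hu : u ∈ cmpt F X v) :
    ∃ e ∈ F, e ∉ X ∧ u ∈ e := by
  by_contra hcon
  push Not at hcon
  have hsub : cmpt F X v ⊆ {u} := by
    intro y hy
    rw [mem_cmp] at hy hu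
    obtain ⟨p⟩ := hu.symm.trans hy
    cases p with
    | nil => simp
    | cons h p =>
      have := gX_adj h
      exact absurd (Sym2.mem_mk_left _ _) (hcon _ this.1 this.2)
  have := Finset.sum_le_sum_of_subset (f := w) hsub
  simp at this
  have := hw u
  omega

theorem tele (N : ℕ) (f : ℕ → ZMod 2) : ∑ b ∈ Finset.range N, (f b + f (b + 1)) = f 0 + f N := by
  have := Finset.sum_range_sub f N
  rw [add_comm, ← CharTwo.sub_eq_add, ← this]
  apply Finset.sum_congr rfl
  intro b _
  rw [CharTwo.sub_eq_add, add_comm]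

theorem sep [Fintype V] (L : LatSys F Z N z) (w : V → ℕ) (hw : ∀ v, 4 * w v ≤ 3 * ∑ v, w v)
    {R : ℕ} (hR0 : 0 < R) (hR : ∑ e ∈ F, (strN F Z e).card ≤ R ^ 2) :
    ∃ X ⊆ F, X.card ≤ 5 * R ∧ ∀ v, 4 * ∑ u ∈ cmpt F X v, w u ≤ 3 * ∑ v, w v := by
  by_contra hcon
  push Not at hcon
  obtain ⟨τ, hτ, hX0⟩ := exists_cut L hR0 hR
  set X0 := cutX F Z N R τ with hX0def
  have hX0F : X0 ⊆ F := by
    classical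
    intro e he; simp only [X0, cutX, Finset.mem_filter] at he; exact he.1
  obtain ⟨v0, hv0⟩ := hcon X0 hX0F (by omega)
  set b0 := (dd F Z N (z v0) + τ) / R with hb0
  set B := bnd F Z N R τ b0
  -- constancy of band
  have hconst : ∀ e ∈ F, e ∉ X0 → ∀ p ∈ Z e, ∀ q ∈ Z e,
      (dd F Z N p + τ) / R = (dd F Z N q + τ) / R := by
    intro e he hX p hp q hq
    by_contra hne
    exact hX (by simp only [X0, cutX, Finset.mem_filter]; exact ⟨he, p, hp, q, hq, hne⟩)
  have hband : ∀ u, (gX F X0).Reachable v0 u → (dd F Z N (z u) + τ) / R = b0 := by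
    intro u hu
    rw [SimpleGraph.reachable_iff_reflTransGen] at hu
    induction hu with
    | refl => rfl
    | tail _ hs ih =>
      have := gX_adj hs
      rw [← ih]
      exact hconst _ this.1 this.2 _ (L.hz _ this.1 _ (Sym2.mem_mk_right _ _)) _
        (L.hz _ this.1 _ (Sym2.mem_mk_left _ _))
  have hP := fun x : ℕ × ℕ => band_path (F := F) (Z := Z) (N := N) (τ := τ) (b0 := b0) hR0 hR x
  choose! T c hRc hTc hcb using hP
  -- cut sets
  set X : ℕ × ℕ → ℕ × ℕ → Finset (Sym2 V) := fun x y => X0 ∪ ((T x ∩ B) ∪ (T y ∩ B)) with hXdef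
  have hbig : ∀ x y : ℕ × ℕ, ∃ v, (x.1 ≤ N ∧ x.2 ≤ N) → (y.1 ≤ N ∧ y.2 ≤ N) →
      3 * ∑ v, w v < 4 * ∑ u ∈ cmpt F (X x y) v, w u := by
    intro x y
    by_cases hx : (x.1 ≤ N ∧ x.2 ≤ N) ∧ (y.1 ≤ N ∧ y.2 ≤ N)
    · obtain ⟨v, hv⟩ := hcon (X x y) (by
        apply Finset.union_subset hX0F
        apply Finset.union_subset
        · exact Finset.inter_subset_left.trans ((hRc x hx.1).inv L).2.2.1
        · exact Finset.inter_subset_left.trans ((hRc y hx.2).inv L).2.2.1) (by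
        have h1 := Finset.card_union_le X0 ((T x ∩ B) ∪ (T y ∩ B))
        have h2 := Finset.card_union_le (T x ∩ B) (T y ∩ B)
        have h3 : (T x ∩ B).card ≤ 2 * R := hTc x hx.1
        have h4 : (T y ∩ B).card ≤ 2 * R := hTc y hx.2
        simp only [hXdef]
        omega)
      exact ⟨v, fun _ _ => hv⟩
    · exact ⟨v0, fun h1 h2 => absurd ⟨h1, h2⟩ hx⟩
  choose vv hvv using hbig
  set inn : ℕ × ℕ → ℕ × ℕ → ℕ × ℕ → ZMod 2 := fun x y u => c x u + chi u x y + c y u with hinn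
  set φ : ℕ × ℕ → ℕ × ℕ → ZMod 2 := fun x y => inn x y (z (vv x y)) with hφ
  -- edges surviving at the component lie in the band and avoid T x, T y
  have hav : ∀ x y, (x.1 ≤ N ∧ x.2 ≤ N) → (y.1 ≤ N ∧ y.2 ≤ N) → ∀ u ∈ cmpt F (X x y) (vv x y),
      ∀ e ∈ F, e ∉ X x y → u ∈ e → e ∉ T x ∧ e ∉ T y := by
    intro x y hx hy u hu e he heX hue
    obtain ⟨u0, h1, h2, _, _⟩ := heavy4 w _ _ _ _ hv0 (hvv x y hx hy) hv0 hv0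
    rw [mem_cmp] at h1 h2 hu
    have hmono : gX F (X x y) ≤ gX F X0 := gX_mono Finset.subset_union_left
    have h3 : (gX F X0).Reachable v0 u :=
      h1.trans ((h2.symm.trans hu).mono hmono)
    have h4 := hband u h3
    simp only [hXdef, Finset.mem_union, Finset.mem_inter, not_or] at heX
    have heB : e ∈ B := by
      simp only [B, bnd, Finset.mem_filter]
      refine ⟨he, fun p hp => ?_⟩
      rw [← h4]
      exact hconst e he heX.1 p hp _ (L.hz e he u hue)
    exact ⟨fun h => heX.2.1 ⟨h, heB⟩, fun h => heX.2.2 ⟨h, heB⟩⟩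
  have hnot : ∀ x, (x.1 ≤ N ∧ x.2 ≤ N) → ∀ e ∈ F, e ∉ T x → x ∉ Z e := by
    intro x hx e he heT hxe
    apply heT
    apply ((hRc x hx).inv L).2.1
    simp only [strAt, Finset.mem_filter]; exact ⟨he, hxe⟩
  have hside : ∀ x y, (x.1 ≤ N ∧ x.2 ≤ N) → (y.1 ≤ N ∧ y.2 ≤ N) → LAdj x y →
      ∀ u ∈ cmpt F (X x y) (vv x y), inn x y (z u) = φ x y := by
    intro x y hx hy hxy u hu
    rw [mem_cmp, SimpleGraph.reachable_iff_reflTransGen] at hu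
    induction hu with
    | refl => rfl
    | tail hr hs ih =>
      rename_i p q
      rw [← ih]
      have hpm : p ∈ cmpt F (X x y) (vv x y) := by
        rw [mem_cmp, SimpleGraph.reachable_iff_reflTransGen]; exact hr
      obtain ⟨heF, heX⟩ := gX_adj hs
      obtain ⟨hx1, hy1⟩ := hav x y hx hy p hpm _ heF heX (Sym2.mem_mk_left _ _)
      have hcn := L.conn _ heF _ (L.hz _ heF p (Sym2.mem_mk_left _ _)) _
        (L.hz _ heF q (Sym2.mem_mk_right _ _))
      generalize z q = zq at hcn
      induction hcn with
      | refl => rfl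
      | tail _ hst ih2 =>
        rename_i m n _
        rw [← ih2]
        obtain ⟨hmn, hm, hn⟩ := hst
        have e1 := ((hRc x hx).inv L).2.2.2 _ heF hx1 m hm n hn hmn
        have e2 := ((hRc y hy).inv L).2.2.2 _ heF hy1 m hm n hn hmn
        have hxZ := hnot x hx _ heF hx1
        have hyZ := hnot y hy _ heF hy1
        have e3 := chi_step hmn hxy (fun h => hxZ (h ▸ hm)) (fun h => hxZ (h ▸ hn))
          (fun h => hyZ (h ▸ hm)) (fun h => hyZ (h ▸ hn))
        rw [← sub_eq_zero, CharTwo.sub_eq_add]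
        simp only [hinn]
        have k1 := zz (gpot m n x)
        have k2 := zz (gpot m n y)
        linear_combination e1 + e2 + e3 + k1 + k2
  have hint : ∀ x y, (x.1 ≤ N ∧ x.2 ≤ N) → (y.1 ≤ N ∧ y.2 ≤ N) → 
      ∀ u ∈ cmpt F (X x y) (vv x y), z u ≠ x ∧ z u ≠ y ∧
        (0 < (z u).1 ∧ (z u).1 < N ∧ 0 < (z u).2 ∧ (z u).2 < N) := by
    intro x y hx hy u hu
    obtain ⟨e, he, heX, hue⟩ := heavy_edge w hw (hvv x y hx hy) hu
    obtain ⟨h1, h2⟩ := hav x y hx hy u hu e he heX hue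
    have h3 := L.hz e he u hue
    exact ⟨fun h => hnot x hx e he h1 (h ▸ h3), fun h => hnot y hy e he h2 (h ▸ h3), L.box e he _ h3⟩
  -- squares
  have hsq : ∀ a b, a < N → b < N →
      φ (a, b) (a + 1, b) + φ (a, b + 1) (a + 1, b + 1)
        + (φ (a, b) (a, b + 1) + φ (a + 1, b) (a + 1, b + 1)) = 0 := by
    intro a b ha hb
    have q1 : ((a, b) : ℕ × ℕ).1 ≤ N ∧ ((a, b) : ℕ × ℕ).2 ≤ N := by simp; omega
    have q2 : ((a + 1, b) : ℕ × ℕ).1 ≤ N ∧ ((a + 1, b) : ℕ × ℕ).2 ≤ N := by simp; omega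
    have q3 : ((a, b + 1) : ℕ × ℕ).1 ≤ N ∧ ((a, b + 1) : ℕ × ℕ).2 ≤ N := by simp; omega
    have q4 : ((a + 1, b + 1) : ℕ × ℕ).1 ≤ N ∧ ((a + 1, b + 1) : ℕ × ℕ).2 ≤ N := by simp; omega
    obtain ⟨u, u1, u2, u3, u4⟩ := heavy4 w _ _ _ _ (hvv _ _ q1 q2) (hvv _ _ q3 q4)
      (hvv _ _ q1 q3) (hvv _ _ q2 q4)
    rw [← hside _ _ q1 q2 (by simp [LAdj]) u u1, ← hside _ _ q3 q4 (by simp [LAdj]) u u2,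
      ← hside _ _ q1 q3 (by simp [LAdj]) u u3, ← hside _ _ q2 q4 (by simp [LAdj]) u u4]
    have i1 := hint _ _ q1 q2 u u1
    have i2 := hint _ _ q3 q4 u u2
    have := chi_square (u := z u) i1.1.symm i1.2.1.symm i2.1.symm i2.2.1.symm
    simp only [hinn]
    linear_combination this + zz (c (a, b) (z u)) + zz (c (a + 1, b) (z u))
      + zz (c (a, b + 1) (z u)) + zz (c (a + 1, b + 1) (z u))
  have hsum : ∑ a ∈ Finset.range N, ∑ b ∈ Finset.range N,
      (φ (a, b) (a + 1, b) + φ (a, b + 1) (a + 1, b + 1)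
        + (φ (a, b) (a, b + 1) + φ (a + 1, b) (a + 1, b + 1))) = 0 := by
    apply Finset.sum_eq_zero
    intro a ha
    apply Finset.sum_eq_zero
    intro b hb
    exact hsq a b (Finset.mem_range.mp ha) (Finset.mem_range.mp hb)
  simp only [Finset.sum_add_distrib] at hsum
  have t1 : ∑ a ∈ Finset.range N, ∑ b ∈ Finset.range N,
      (φ (a, b) (a + 1, b) + φ (a, b + 1) (a + 1, b + 1)) =
      ∑ a ∈ Finset.range N, (φ (a, 0) (a + 1, 0) + φ (a, N) (a + 1, N)) :=
    Finset.sum_congr rfl fun a _ => tele N (fun b => φ (a, b) (a + 1, b))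
  have t2 : ∑ a ∈ Finset.range N, ∑ b ∈ Finset.range N,
      (φ (a, b) (a, b + 1) + φ (a + 1, b) (a + 1, b + 1)) =
      ∑ b ∈ Finset.range N, (φ (0, b) (0, b + 1) + φ (N, b) (N, b + 1)) := by
    rw [Finset.sum_comm]
    exact Finset.sum_congr rfl fun b _ => tele N (fun a => φ (a, b) (a, b + 1))
  simp only [Finset.sum_add_distrib] at t1 t2
  rw [t1, t2] at hsum
  have hself : ∀ x y, (x.1 ≤ N ∧ x.2 ≤ N) → (y.1 ≤ N ∧ y.2 ≤ N) →
      vv x y ∈ cmpt F (X x y) (vv x y) := fun x y _ _ => mem_cmp.mpr (SimpleGraph.Reachable.refl _)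
  have hval : ∀ x y, (x.1 ≤ N ∧ x.2 ≤ N) → (y.1 ≤ N ∧ y.2 ≤ N) → 
      (x.1 = 0 ∨ x.1 = N ∨ x.2 = 0 ∨ x.2 = N) → (y.1 = 0 ∨ y.1 = N ∨ y.2 = 0 ∨ y.2 = N) →
      ∃ i j, 0 < i ∧ i < N ∧ 0 < j ∧ j < N ∧
        φ x y = c0 N x (i, j) + chi (i, j) x y + c0 N y (i, j) := by
    intro x y hx hy bx hby
    have := (hint x y hx hy _ (hself x y hx hy)).2.2
    refine ⟨(z (vv x y)).1, (z (vv x y)).2, this.1, this.2.1, this.2.2.1, this.2.2.2, ?_⟩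
    simp only [hφ, hinn]
    rw [hcb x hx bx, hcb y hy hby]
  have v1 : ∀ a ∈ Finset.range N, φ (a, 0) (a + 1, 0) = 0 := by
    intro a ha
    have ha := Finset.mem_range.mp ha
    obtain ⟨i, j, h1, h2, h3, h4, h⟩ := hval (a, 0) (a + 1, 0) (by simp; omega) (by simp; omega)
      (by simp) (by simp)
    rw [h]
    simp only [c0, chi]
    split_ifs <;> first | (exfalso; omega) | simp
  have v2 : ∀ a ∈ Finset.range N, φ (a, N) (a + 1, N) = if a = N - 1 then 1 else 0 := by
    intro a ha
    have ha := Finset.mem_range.mp ha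
    obtain ⟨i, j, h1, h2, h3, h4, h⟩ := hval (a, N) (a + 1, N) (by simp; omega) (by simp; omega)
      (by simp) (by simp)
    rw [h]
    simp only [c0, chi, true_and]
    split_ifs <;> first | (exfalso; omega) | simp [one_add_one_zmod]
  have v3 : ∀ b ∈ Finset.range N, φ (0, b) (0, b + 1) = 0 := by
    intro a ha
    have ha := Finset.mem_range.mp ha
    obtain ⟨i, j, h1, h2, h3, h4, h⟩ := hval (0, a) (0, a + 1) (by simp; omega) (by simp; omega)
      (by simp) (by simp)
    rw [h]
    simp only [c0, chi, true_and]
    split_ifs <;> first | (exfalso; omega) | simp [one_add_one_zmod]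
  have v4 : ∀ b ∈ Finset.range N, φ (N, b) (N, b + 1) = 0 := by
    intro a ha
    have ha := Finset.mem_range.mp ha
    obtain ⟨i, j, h1, h2, h3, h4, h⟩ := hval (N, a) (N, a + 1) (by simp; omega) (by simp; omega)
      (by simp) (by simp)
    rw [h]
    simp only [c0, chi, true_and]
    split_ifs <;> first | (exfalso; omega) | simp [one_add_one_zmod]
  rw [Finset.sum_congr rfl v1, Finset.sum_congr rfl v2, Finset.sum_congr rfl v3,
    Finset.sum_congr rfl v4] at hsum
  have hN : 0 < N := by
    have := (hint (0, 0) (0, 0) (by simp) (by simp) _ (hself _ _ (by simp) (by simp))).2.2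
    omega
  rw [Finset.sum_ite_eq'] at hsum
  simp [hN] at hsum

end Sep2
section Recur
variable {V : Type*} [DecidableEq V]

theorem LatSys.mono {F F' : Finset (Sym2 V)} {Z : Sym2 V → Set (ℕ × ℕ)} {N : ℕ} {z : V → ℕ × ℕ}
    (L : LatSys F Z N z) (h : F' ⊆ F) : LatSys F' Z N z :=
  ⟨fun e he => L.box e (h he), fun e he => L.conn e (h he), fun e he => L.hz e (h he)⟩

variable [Fintype V] (G : SimpleGraph V) [DecidableRel G.Adj]
  (Z : Sym2 V → Set (ℕ × ℕ)) {N : ℕ} {z : V → ℕ × ℕ}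

open Classical in
noncomputable def FA (A : Finset V) : Finset (Sym2 V) :=
  G.edgeFinset.filter (fun e => ∀ v ∈ e, v ∈ A)

theorem mem_FA {A : Finset V} {u v : V} : s(u, v) ∈ FA G A ↔ G.Adj u v ∧ u ∈ A ∧ v ∈ A := by
  simp [FA]

theorem FA_sub (A : Finset V) : FA G A ⊆ G.edgeFinset := by
  classical
  intro e he; simp only [FA, Finset.mem_filter] at he; exact he.1

theorem FA_mono {A B : Finset V} (h : A ⊆ B) : FA G A ⊆ FA G B := by
  intro e
  induction e with | _ u v => 
  simp only [mem_FA]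
  exact fun ⟨h1, h2, h3⟩ => ⟨h1, h h2, h h3⟩

noncomputable def mA (A : Finset V) : ℕ := ∑ e ∈ FA G A, (strN (FA G A) Z e).card

theorem strN_mono {F F' : Finset (Sym2 V)} (h : F ⊆ F') (e : Sym2 V) : strN F Z e ⊆ strN F' Z e := by
  intro f hf
  simp only [strN, Finset.mem_filter] at hf ⊢
  exact ⟨h hf.1, hf.2⟩

theorem mA_add {A B C : Finset V} (hd : Disjoint A B) (h : A ∪ B = C) :
    mA G Z A + mA G Z B ≤ mA G Z C := by
  have hA : FA G A ⊆ FA G C := FA_mono G (h ▸ Finset.subset_union_left)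
  have hB : FA G B ⊆ FA G C := FA_mono G (h ▸ Finset.subset_union_right)
  have hdis : Disjoint (FA G A) (FA G B) := by
    rw [Finset.disjoint_left]
    intro e
    induction e with | _ u v => 
    simp only [mem_FA]
    intro h1 h2
    exact Finset.disjoint_left.mp hd h1.2.1 h2.2.1
  calc mA G Z A + mA G Z B
      ≤ ∑ e ∈ FA G A, (strN (FA G C) Z e).card + ∑ e ∈ FA G B, (strN (FA G C) Z e).card := by
        apply add_le_add
        · exact Finset.sum_le_sum fun e _ => Finset.card_le_card (strN_mono Z hA e)
        · exact Finset.sum_le_sum fun e _ => Finset.card_le_card (strN_mono Z hB e)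
    _ = ∑ e ∈ FA G A ∪ FA G B, (strN (FA G C) Z e).card := (Finset.sum_union hdis).symm
    _ ≤ _ := Finset.sum_le_sum_of_subset (Finset.union_subset hA hB)

def bb (A B : Finset V) : ℕ := ((A ×ˢ B).filter (fun p => G.Adj p.1 p.2)).card

theorem split (L : LatSys G.edgeFinset Z N z) (A : Finset V) (w : V → ℕ)
    (hw : ∀ v ∈ A, 4 * w v ≤ 3 * ∑ v ∈ A, w v) :
    ∃ A1 A2, Disjoint A1 A2 ∧ A1 ∪ A2 = A ∧ 4 * ∑ v ∈ A1, w v ≤ 3 * ∑ v ∈ A, w v ∧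
      4 * ∑ v ∈ A2, w v ≤ 3 * ∑ v ∈ A, w v ∧ bb G A1 A2 ^ 2 ≤ 100 * mA G Z A := by
  classical
  set w' : V → ℕ := fun v => if v ∈ A then w v else 0 with hw'
  have hW : ∑ v, w' v = ∑ v ∈ A, w v := by simp [hw']
  set m := mA G Z A with hm
  set R := Nat.sqrt m + 1 with hRdef
  obtain ⟨X, hXF, hXc, hX⟩ := sep (L.mono (FA_sub G A)) w' (by
      intro v
      rw [hW]
      by_cases hv : v ∈ A
      · simp [hw', hv]; exact hw v hv
      · simp [hw', hv]) (R := R) (by omega) (by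
      have := Nat.lt_succ_sqrt m
      rw [pow_two]
      exact le_of_lt this)
  set W := ∑ v ∈ A, w v
  rw [hW] at hX
  set cl : Finset V → Prop := fun U => ∀ u ∈ U, ∀ v, (gX (FA G A) X).Adj u v → v ∈ U with hcl
  obtain ⟨U, hU, hmax⟩ := Finset.exists_max_image
    ((Finset.univ : Finset (Finset V)).filter (fun U => cl U ∧ 4 * ∑ v ∈ U, w' v ≤ 3 * W))
    (fun U => ∑ v ∈ U, w' v) ⟨∅, by simp [hcl]⟩
  simp only [Finset.mem_filter, Finset.mem_univ, true_and] at hU hmax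
  have hclr : ∀ u ∈ U, ∀ v, (gX (FA G A) X).Reachable u v → v ∈ U := by
    intro u hu v hv
    rw [SimpleGraph.reachable_iff_reflTransGen] at hv
    induction hv with
    | refl => exact hu
    | tail _ hs ih => exact hU.1 _ ih _ hs
  have hUc : 4 * ∑ v ∈ Uᶜ, w' v ≤ 3 * W := by
    by_contra hcon
    push Not at hcon
    have hsum : ∑ v ∈ U, w' v + ∑ v ∈ Uᶜ, w' v = W := by
      rw [Finset.sum_add_sum_compl, hW]
    obtain ⟨v, hv, hv0⟩ : ∃ v ∈ Uᶜ, w' v ≠ 0 := by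
      by_contra hh
      push Not at hh
      rw [Finset.sum_eq_zero hh] at hcon
      omega
    set K := cmpt (FA G A) X v with hK
    have hKcl : cl K := by
      intro u hu y hy
      rw [hK, mem_cmp] at hu ⊢
      exact hu.trans hy.reachable
    have hKd : Disjoint U K := by
      rw [Finset.disjoint_left]
      intro u hu huK
      rw [hK, mem_cmp] at huK
      exact (Finset.mem_compl.mp hv) (hclr u hu v huK.symm)
    have hKpos : w' v ≤ ∑ u ∈ K, w' u :=
      Finset.single_le_sum (f := w') (fun _ _ => Nat.zero_le _)
        (mem_cmp.mpr (SimpleGraph.Reachable.refl _))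
    have hKle := hX v
    have m1 := hmax K ⟨hKcl, hKle⟩
    have m2 := hmax (U ∪ K) 
    rw [Finset.sum_union hKd] at m2
    have hc : cl (U ∪ K) := by
      intro u hu y hy
      rcases Finset.mem_union.mp hu with h | h
      · exact Finset.mem_union_left _ (hU.1 u h y hy)
      · exact Finset.mem_union_right _ (hKcl u h y hy)
    by_cases h4 : 4 * (∑ v ∈ U, w' v + ∑ u ∈ K, w' u) ≤ 3 * W
    · have := m2 ⟨hc, h4⟩
      omega
    · omega
  have hs : ∀ S : Finset V, ∑ v ∈ A ∩ S, w v = ∑ v ∈ S, w' v := by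
    intro S
    rw [hw', Finset.sum_ite_mem, Finset.inter_comm]
  refine ⟨A ∩ U, A ∩ Uᶜ, ?_, ?_, ?_, ?_, ?_⟩
  · rw [Finset.disjoint_left]
    intro u h1 h2
    simp at h1 h2; exact h2.2 h1.2
  · ext u; simp only [Finset.mem_union, Finset.mem_inter, Finset.mem_compl]; tauto
  · rw [hs]; exact hU.2
  · rw [hs]; exact hUc
  · have hbX : bb G (A ∩ U) (A ∩ Uᶜ) ≤ X.card := by
      unfold bb
      apply Finset.card_le_card_of_injOn (fun p => s(p.1, p.2))
      · rintro ⟨a, b⟩ hp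
        simp only [Finset.coe_filter, Finset.mem_product, Finset.mem_inter, Finset.mem_compl,
          Set.mem_ofPred_eq] at hp
        simp only [Finset.mem_coe]
        by_contra hn
        apply hp.1.2.2
        apply hU.1 a hp.1.1.2
        simp only [gX, SimpleGraph.fromEdgeSet_adj, Finset.coe_sdiff, Set.mem_sdiff, Finset.mem_coe]
        exact ⟨⟨(mem_FA G).mpr ⟨hp.2, hp.1.1.1, hp.1.2.1⟩, hn⟩, hp.2.ne⟩
      · rintro ⟨a, b⟩ hp ⟨a', b'⟩ hp' heq
        simp only [Finset.coe_filter, Finset.mem_product, Finset.mem_inter, Finset.mem_compl,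
          Set.mem_ofPred_eq] at hp hp'
        simp only [Sym2.eq_iff] at heq
        rcases heq with ⟨rfl, rfl⟩ | ⟨rfl, rfl⟩
        · rfl
        · exact absurd hp.1.1.2 hp'.1.2.2
    have hFm : (FA G A).card ≤ m := by
      rw [hm, mA, Finset.card_eq_sum_ones]
      apply Finset.sum_le_sum
      intro e he
      apply Finset.card_pos.mpr
      refine ⟨e, ?_⟩
      simp only [strN, Finset.mem_filter]
      refine ⟨he, ?_⟩
      induction e with | _ u v => 
      have := (L.mono (FA_sub G A)).hz _ he u (Sym2.mem_mk_left _ _)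
      exact ⟨_, this, this⟩
    by_cases hm0 : m = 0
    · have := Finset.card_le_card hXF
      have : bb G (A ∩ U) (A ∩ Uᶜ) = 0 := by omega
      rw [this]; simp
    · have h1 : 1 ≤ Nat.sqrt m := Nat.sqrt_pos.mpr (by omega)
      have h2 := Nat.sqrt_le m
      have h3 : bb G (A ∩ U) (A ∩ Uᶜ) ≤ 10 * Nat.sqrt m := by omega
      calc bb G (A ∩ U) (A ∩ Uᶜ) ^ 2 ≤ (10 * Nat.sqrt m) ^ 2 := Nat.pow_le_pow_left h3 2
        _ = 100 * (Nat.sqrt m * Nat.sqrt m) := by ring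
        _ ≤ _ := by omega

/-- crossing pattern relative to a block -/
def Cp (A : Finset V) (ρ : V → ℕ) (e f : Sym2 V) : Prop :=
  ∃ p q u u', f = s(p, q) ∧ e = s(u, u') ∧ p ∈ A ∧ q ∈ A ∧ u ∈ A ∧ ρ p < ρ u ∧ ρ u < ρ q ∧
    (u' ∈ A → ρ u' < ρ p ∨ ρ q < ρ u')

open Classical in
noncomputable def Sp (A : Finset V) (ρ : V → ℕ) : Finset (Sym2 V × Sym2 V) :=
  (G.edgeFinset ×ˢ G.edgeFinset).filter (fun x => Cp A ρ x.1 x.2 ∨ Cp A ρ x.2 x.1)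

theorem mem_Sp {A : Finset V} {ρ : V → ℕ} {e f : Sym2 V} : (e, f) ∈ Sp G A ρ ↔
    (e ∈ G.edgeFinset ∧ f ∈ G.edgeFinset) ∧ (Cp A ρ e f ∨ Cp A ρ f e) := by
  simp only [Sp, Finset.mem_filter, Finset.mem_product]

theorem merge (A1 A2 A : Finset V) (hd : Disjoint A1 A2) (hA : A1 ∪ A2 = A) (ρ1 ρ2 : V → ℕ)
    (h1 : Set.InjOn ρ1 A1) (h2 : Set.InjOn ρ2 A2) :
    ∃ ρ : V → ℕ, Set.InjOn ρ A ∧ (Sp G A ρ).card ≤ (Sp G A1 ρ1).card + (Sp G A2 ρ2).card +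
      bb G A1 A2 ^ 2 + 2 * (bb G A1 A2 * bb G A Aᶜ) := by
  classical
  have hnd : ∀ v, v ∈ A1 → v ∈ A2 → False := fun v a b => Finset.disjoint_left.mp hd a b
  have hA' : ∀ v, v ∈ A ↔ v ∈ A1 ∨ v ∈ A2 := by intro v; rw [← hA]; simp
  set M := A1.sup ρ1 + 1 with hM
  set ρ : V → ℕ := fun v => if v ∈ A1 then ρ1 v else M + ρ2 v with hρ
  have r1 : ∀ v ∈ A1, ρ v = ρ1 v := fun v hv => by simp [hρ, hv]
  have r2 : ∀ v ∈ A2, ρ v = M + ρ2 v := fun v hv => by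
    have : v ∉ A1 := fun h => hnd v h hv
    simp [hρ, this]
  have r3 : ∀ v ∈ A1, ρ1 v < M := fun v hv => by
    have := Finset.le_sup (f := ρ1) hv
    omega
  have o11 : ∀ u ∈ A1, ∀ v ∈ A1, (ρ u < ρ v ↔ ρ1 u < ρ1 v) := fun u hu v hv => by
    rw [r1 u hu, r1 v hv]
  have o22 : ∀ u ∈ A2, ∀ v ∈ A2, (ρ u < ρ v ↔ ρ2 u < ρ2 v) := fun u hu v hv => by
    rw [r2 u hu, r2 v hv]; omega
  have o12 : ∀ u ∈ A1, ∀ v ∈ A2, ρ u < ρ v := fun u hu v hv => by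
    rw [r1 u hu, r2 v hv]; have := r3 u hu; omega
  refine ⟨ρ, ?_, ?_⟩
  · intro u hu v hv huv
    rw [Finset.mem_coe, hA'] at hu hv
    rcases hu with hu | hu <;> rcases hv with hv | hv
    · rw [r1 u hu, r1 v hv] at huv; exact h1 hu hv huv
    · have := o12 u hu v hv; omega
    · have := o12 v hv u hu; omega
    · rw [r2 u hu, r2 v hv] at huv; exact h2 hu hv (by omega)
  · set Xc : Finset (Sym2 V) := ((A1 ×ˢ A2).filter (fun p => G.Adj p.1 p.2)).image
      (fun p => s(p.1, p.2)) with hXc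
    set Ex : Finset (Sym2 V) := ((A ×ˢ Aᶜ).filter (fun p => G.Adj p.1 p.2)).image
      (fun p => s(p.1, p.2)) with hEx
    have cX : Xc.card ≤ bb G A1 A2 := Finset.card_image_le
    have cE : Ex.card ≤ bb G A Aᶜ := Finset.card_image_le
    have key : ∀ e ∈ G.edgeFinset, ∀ f ∈ G.edgeFinset, Cp A ρ e f →
        (Cp A1 ρ1 e f ∨ Cp A1 ρ1 f e ∨ Cp A2 ρ2 e f ∨ Cp A2 ρ2 f e) ∨
          (f ∈ Xc ∧ (e ∈ Xc ∨ e ∈ Ex)) := by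
      rintro e he f hf ⟨p, q, u, u', rfl, rfl, hp, hq, hu, hpu, huq, hc⟩
      rw [SimpleGraph.mem_edgeFinset, SimpleGraph.mem_edgeSet] at he hf
      rw [hA'] at hp hq hu
      rcases hp with hp | hp
      · rcases hq with hq | hq
        · -- both in A1
          left; left
          have hu1 : u ∈ A1 := by
            rcases hu with hu | hu
            · exact hu
            · have := o12 q hq u hu; omega
          refine ⟨p, q, u, u', rfl, rfl, hp, hq, hu1, (o11 _ hp _ hu1).mp hpu,
            (o11 _ hu1 _ hq).mp huq, fun hu' => ?_⟩
          rw [← o11 _ hu' _ hp, ← o11 _ hq _ hu']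
          exact hc ((hA' _).mpr (Or.inl hu'))
        · have hfX : s(p, q) ∈ Xc := by
            simp only [hXc, Finset.mem_image, Finset.mem_filter, Finset.mem_product]
            exact ⟨(p, q), ⟨⟨hp, hq⟩, hf⟩, rfl⟩
          by_cases hu'A : u' ∈ A
          · have hc' := hc hu'A
            rw [hA'] at hu'A
            rcases hu with hu | hu <;> rcases hu'A with hu' | hu'
            · left; right; left
              have : ρ u' < ρ p := by
                rcases hc' with h | h
                · exact h
                · have := o12 u' hu' q hq; omega
              refine ⟨u', u, p, q, Sym2.eq_swap, rfl, hu', hu, hp, (o11 _ hu' _ hp).mp this,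
                (o11 _ hp _ hu).mp hpu, fun h => absurd hq (fun h' => hnd _ h h')⟩
            · right
              refine ⟨hfX, Or.inl ?_⟩
              simp only [hXc, Finset.mem_image, Finset.mem_filter, Finset.mem_product]
              exact ⟨(u, u'), ⟨⟨hu, hu'⟩, he⟩, rfl⟩
            · right
              refine ⟨hfX, Or.inl ?_⟩
              simp only [hXc, Finset.mem_image, Finset.mem_filter, Finset.mem_product]
              exact ⟨(u', u), ⟨⟨hu', hu⟩, he.symm⟩, Sym2.eq_swap⟩
            · left; right; right; right
              have : ρ q < ρ u' := by
                rcases hc' with h | h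
                · have := o12 p hp u' hu'; omega
                · exact h
              refine ⟨u, u', q, p, rfl, Sym2.eq_swap, hu, hu', hq, (o22 _ hu _ hq).mp huq,
                (o22 _ hq _ hu').mp this, fun h => absurd h (fun h' => hnd _ hp h')⟩
          · right
            refine ⟨hfX, Or.inr ?_⟩
            simp only [hEx, Finset.mem_image, Finset.mem_filter, Finset.mem_product,
              Finset.mem_compl]
            exact ⟨(u, u'), ⟨⟨(hA' _).mpr hu, hu'A⟩, he⟩, rfl⟩
      · have hq2 : q ∈ A2 := by
          rcases hq with hq | hq
          · have := o12 q hq p hp; omega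
          · exact hq
        have hu2 : u ∈ A2 := by
          rcases hu with hu | hu
          · have := o12 u hu p hp; omega
          · exact hu
        left; right; right; left
        refine ⟨p, q, u, u', rfl, rfl, hp, hq2, hu2, (o22 _ hp _ hu2).mp hpu,
            (o22 _ hu2 _ hq2).mp huq, fun hu' => ?_⟩
        rw [← o22 _ hu' _ hp, ← o22 _ hq2 _ hu']
        exact hc ((hA' _).mpr (Or.inr hu'))
    have hsub : Sp G A ρ ⊆ (Sp G A1 ρ1 ∪ Sp G A2 ρ2) ∪ (Xc ×ˢ Xc ∪ (Xc ×ˢ Ex ∪ Ex ×ˢ Xc)) := by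
      rintro ⟨e, f⟩ h
      rw [mem_Sp] at h
      obtain ⟨⟨he, hf⟩, h⟩ := h
      simp only [Finset.mem_union, mem_Sp, Finset.mem_product]
      rcases h with h | h
      · rcases key e he f hf h with (h | h | h | h) | ⟨h1, h2 | h2⟩
        · exact Or.inl (Or.inl ⟨⟨he, hf⟩, Or.inl h⟩)
        · exact Or.inl (Or.inl ⟨⟨he, hf⟩, Or.inr h⟩)
        · exact Or.inl (Or.inr ⟨⟨he, hf⟩, Or.inl h⟩)
        · exact Or.inl (Or.inr ⟨⟨he, hf⟩, Or.inr h⟩)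
        · exact Or.inr (Or.inl ⟨h2, h1⟩)
        · exact Or.inr (Or.inr (Or.inr ⟨h2, h1⟩))
      · rcases key f hf e he h with (h | h | h | h) | ⟨h1, h2 | h2⟩
        · exact Or.inl (Or.inl ⟨⟨he, hf⟩, Or.inr h⟩)
        · exact Or.inl (Or.inl ⟨⟨he, hf⟩, Or.inl h⟩)
        · exact Or.inl (Or.inr ⟨⟨he, hf⟩, Or.inr h⟩)
        · exact Or.inl (Or.inr ⟨⟨he, hf⟩, Or.inl h⟩)
        · exact Or.inr (Or.inl ⟨h1, h2⟩)
        · exact Or.inr (Or.inr (Or.inl ⟨h1, h2⟩))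
    have c1 := Finset.card_le_card hsub
    have c2 := Finset.card_union_le (Sp G A1 ρ1 ∪ Sp G A2 ρ2) (Xc ×ˢ Xc ∪ (Xc ×ˢ Ex ∪ Ex ×ˢ Xc))
    have c3 := Finset.card_union_le (Sp G A1 ρ1) (Sp G A2 ρ2)
    have c4 := Finset.card_union_le (Xc ×ˢ Xc) (Xc ×ˢ Ex ∪ Ex ×ˢ Xc)
    have c5 := Finset.card_union_le (Xc ×ˢ Ex) (Ex ×ˢ Xc)
    simp only [Finset.card_product] at c4 c5
    have m1 : Xc.card * Xc.card ≤ bb G A1 A2 ^ 2 := by rw [pow_two]; exact Nat.mul_le_mul cX cX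
    have m2 : Xc.card * Ex.card ≤ bb G A1 A2 * bb G A Aᶜ := Nat.mul_le_mul cX cE
    have m3 : Ex.card * Xc.card ≤ bb G A1 A2 * bb G A Aᶜ := by rw [mul_comm]; exact m2
    omega

end Recur
set_option linter.unusedSectionVars false
section Recur2
variable {V : Type*} [DecidableEq V] [Fintype V] (G : SimpleGraph V) [DecidableRel G.Adj]
  (Z : Sym2 V → Set (ℕ × ℕ)) {N : ℕ} {z : V → ℕ × ℕ}

theorem bb_eq (A B : Finset V) : bb G A B = ∑ v ∈ A, (B.filter (fun u => G.Adj v u)).card := by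
  unfold bb
  rw [Finset.card_filter, Finset.sum_product]
  apply Finset.sum_congr rfl
  intro v _
  rw [Finset.card_filter]

theorem bb_symm (A B : Finset V) : bb G A B = bb G B A := by
  unfold bb
  apply Finset.card_bij (fun p _ => (p.2, p.1))
  · rintro ⟨a, b⟩ h
    simp only [Finset.mem_filter, Finset.mem_product] at h ⊢
    exact ⟨⟨h.1.2, h.1.1⟩, h.2.symm⟩
  · rintro ⟨a, b⟩ _ ⟨c, d⟩ _ h
    simp only [Prod.mk.injEq] at h ⊢
    exact ⟨h.2, h.1⟩
  · rintro ⟨a, b⟩ h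
    simp only [Finset.mem_filter, Finset.mem_product] at h
    refine ⟨(b, a), ?_, rfl⟩
    simp only [Finset.mem_filter, Finset.mem_product]
    exact ⟨⟨h.1.2, h.1.1⟩, h.2.symm⟩

theorem bb_union (A B C : Finset V) (h : Disjoint B C) : bb G A (B ∪ C) = bb G A B + bb G A C := by
  rw [bb_symm G A (B ∪ C), bb_symm G A B, bb_symm G A C, bb_eq, bb_eq, bb_eq, Finset.sum_union h]

theorem bb_bd {A1 A2 A : Finset V} (hd : Disjoint A1 A2) (hA : A1 ∪ A2 = A) :
    bb G A1 A1ᶜ = bb G A1 A2 + bb G A1 Aᶜ := by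
  have : A1ᶜ = A2 ∪ Aᶜ := by
    ext v
    have : v ∈ A1 → v ∉ A2 := fun h => Finset.disjoint_left.mp hd h
    simp only [← hA, Finset.mem_compl, Finset.mem_union]
    tauto
  rw [this, bb_union]
  rw [Finset.disjoint_left]
  intro v hv
  simp [← hA, hv]

/-- total measure of a block -/
noncomputable def MA (A : Finset V) : ℝ := (mA G Z A : ℝ) + ∑ v ∈ A, (G.degree v : ℝ) ^ 2

theorem MA_ge (A : Finset V) : (mA G Z A : ℝ) ≤ MA G Z A := by
  have : 0 ≤ ∑ v ∈ A, (G.degree v : ℝ) ^ 2 := Finset.sum_nonneg fun _ _ => by positivity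
  unfold MA; linarith

theorem MA_nonneg (A : Finset V) : 0 ≤ MA G Z A :=
  le_trans (Nat.cast_nonneg _) (MA_ge G Z A)

theorem MA_add {A1 A2 A : Finset V} (hd : Disjoint A1 A2) (hA : A1 ∪ A2 = A) :
    MA G Z A1 + MA G Z A2 ≤ MA G Z A := by
  have h1 : (mA G Z A1 : ℝ) + mA G Z A2 ≤ mA G Z A := by exact_mod_cast mA_add G Z hd hA
  have h2 : ∑ v ∈ A, (G.degree v : ℝ) ^ 2 = _ + _ := hA ▸ Finset.sum_union hd
  unfold MA
  rw [h2]; linarith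

theorem bd_sum {A1 A2 A : Finset V} (hd : Disjoint A1 A2) (hA : A1 ∪ A2 = A) :
    bb G A1 Aᶜ + bb G A2 Aᶜ = bb G A Aᶜ := by
  rw [bb_eq, bb_eq, bb_eq, ← Finset.sum_union hd, hA]

theorem ext_split (L : LatSys G.edgeFinset Z N z) (A : Finset V) :
    ∃ A1 A2, Disjoint A1 A2 ∧ A1 ∪ A2 = A ∧ (bb G A1 A2 : ℝ) ^ 2 ≤ 100 * MA G Z A ∧
      (bb G A1 A1ᶜ : ℝ) ^ 2 + (bb G A2 A2ᶜ : ℝ) ^ 2 ≤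
        7 / 8 * (bb G A Aᶜ : ℝ) ^ 2 + 1450 * MA G Z A := by
  have hM := MA_nonneg G Z A
  by_cases hw : ∀ v ∈ A, 4 * (Aᶜ.filter (fun u => G.Adj v u)).card ≤
      3 * ∑ v ∈ A, (Aᶜ.filter (fun u => G.Adj v u)).card
  · obtain ⟨A1, A2, hd, hA, e1, e2, hb⟩ := split G Z L A _ hw
    rw [← bb_eq, ← bb_eq] at e1 e2
    have hb' : (bb G A1 A2 : ℝ) ^ 2 ≤ 100 * MA G Z A := by
      have : (bb G A1 A2 : ℝ) ^ 2 ≤ 100 * mA G Z A := by exact_mod_cast hb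
      linarith [MA_ge G Z A]
    refine ⟨A1, A2, hd, hA, hb', ?_⟩
    rw [bb_bd G hd hA, bb_bd G hd.symm ((Finset.union_comm _ _).trans hA), bb_symm G A2 A1]
    have hs : (bb G A1 Aᶜ : ℝ) + bb G A2 Aᶜ = bb G A Aᶜ := by exact_mod_cast bd_sum G hd hA
    have e1' : 4 * (bb G A1 Aᶜ : ℝ) ≤ 3 * bb G A Aᶜ := by exact_mod_cast e1
    have e2' : 4 * (bb G A2 Aᶜ : ℝ) ≤ 3 * bb G A Aᶜ := by exact_mod_cast e2
    push_cast
    generalize (bb G A1 Aᶜ : ℝ) = x at *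
    generalize (bb G A2 Aᶜ : ℝ) = y at *
    generalize (bb G A1 A2 : ℝ) = b at *
    generalize (bb G A Aᶜ : ℝ) = d at *
    have hy : y = d - x := by linarith
    subst hy
    nlinarith [sq_nonneg (d - 4 * b), mul_nonneg (sub_nonneg.2 e1') (sub_nonneg.2 e2')]
  · push Not at hw
    obtain ⟨v, hv, hlt⟩ := hw
    refine ⟨A, ∅, by simp, by simp, ?_, ?_⟩
    · simp [bb]; exact hM
    · rw [← bb_eq] at hlt
      have hdeg : (Aᶜ.filter (fun u => G.Adj v u)).card ≤ G.degree v := by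
        rw [← SimpleGraph.card_neighborFinset_eq_degree]
        apply Finset.card_le_card
        intro u; simp
      have h1 : 3 * (bb G A Aᶜ : ℝ) ≤ 4 * G.degree v := by
        have : 3 * bb G A Aᶜ ≤ 4 * G.degree v := by omega
        exact_mod_cast this
      have h2 : (G.degree v : ℝ) ^ 2 ≤ MA G Z A := by
        have : (G.degree v : ℝ) ^ 2 ≤ ∑ v ∈ A, (G.degree v : ℝ) ^ 2 :=
          Finset.single_le_sum (f := fun v => (G.degree v : ℝ) ^ 2) (fun _ _ => by positivity) hv
        have h0 : (0 : ℝ) ≤ mA G Z A := Nat.cast_nonneg _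
        unfold MA; linarith
      have h3 : (bb G ∅ (∅ᶜ : Finset V) : ℝ) = 0 := by simp [bb]
      rw [h3]
      have h4 : (0 : ℝ) ≤ bb G A Aᶜ := Nat.cast_nonneg _
      nlinarith

theorem cnt_split (L : LatSys G.edgeFinset Z N z) (A B : Finset V) (hBA : B ⊆ A) (h2 : 2 ≤ A.card) :
    ∃ A1 A2, Disjoint A1 A2 ∧ A1 ∪ A2 = B ∧ 4 * A1.card ≤ 3 * A.card ∧ 4 * A2.card ≤ 3 * A.card ∧
      (bb G A1 A2 : ℝ) ^ 2 ≤ 100 * MA G Z B ∧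
      (bb G A1 A1ᶜ : ℝ) ^ 2 + (bb G A2 A2ᶜ : ℝ) ^ 2 ≤
        16 / 15 * (bb G B Bᶜ : ℝ) ^ 2 + 64 * (bb G A1 A2 : ℝ) ^ 2 := by
  have hM := MA_nonneg G Z B
  have hc := Finset.card_le_card hBA
  by_cases hB : B.card ≤ 1
  · refine ⟨B, ∅, by simp, by simp, by omega, by simp, ?_, ?_⟩
    · simp [bb]; exact hM
    · have h3 : (bb G ∅ (∅ᶜ : Finset V) : ℝ) = 0 := by simp [bb]
      rw [h3]
      nlinarith [sq_nonneg (bb G B Bᶜ : ℝ), sq_nonneg (bb G B ∅ : ℝ)]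
  · obtain ⟨A1, A2, hd, hA, e1, e2, hb⟩ := split G Z L B (fun _ => 1) (by
      intro v _; simp only [Finset.sum_const, smul_eq_mul]; omega)
    simp only [Finset.sum_const, smul_eq_mul, mul_one] at e1 e2
    refine ⟨A1, A2, hd, hA, by omega, by omega, ?_, ?_⟩
    · have : (bb G A1 A2 : ℝ) ^ 2 ≤ 100 * mA G Z B := by exact_mod_cast hb
      linarith [MA_ge G Z B]
    · rw [bb_bd G hd hA, bb_bd G hd.symm ((Finset.union_comm _ _).trans hA), bb_symm G A2 A1]
      have hs : (bb G A1 Bᶜ : ℝ) + bb G A2 Bᶜ = bb G B Bᶜ := by exact_mod_cast bd_sum G hd hA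
      have x0 : (0 : ℝ) ≤ bb G A1 Bᶜ := Nat.cast_nonneg _
      have y0 : (0 : ℝ) ≤ bb G A2 Bᶜ := Nat.cast_nonneg _
      have b0 : (0 : ℝ) ≤ bb G A1 A2 := Nat.cast_nonneg _
      push_cast
      generalize (bb G A1 Bᶜ : ℝ) = x at *
      generalize (bb G A2 Bᶜ : ℝ) = y at *
      generalize (bb G A1 A2 : ℝ) = b at *
      rw [← hs]
      nlinarith [sq_nonneg (x + y - 30 * b), mul_nonneg x0 y0, mul_nonneg x0 b0, mul_nonneg y0 b0,
        mul_nonneg b0 b0]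

theorem main_rec (L : LatSys G.edgeFinset Z N z) : ∀ (k : ℕ) (A : Finset V), A.card = k →
    ∃ ρ : V → ℕ, Set.InjOn ρ A ∧ ((Sp G A ρ).card : ℝ) ≤
      1000000 * Real.log A.card * MA G Z A + 30 * (bb G A Aᶜ : ℝ) ^ 2 := by
  intro k
  induction k using Nat.strong_induction_on with
  | _ k ih =>
  intro A hk
  by_cases hA2 : A.card ≤ 1
  · refine ⟨fun _ => 0, ?_, ?_⟩
    · intro u hu v hv _
      exact Finset.card_le_one.mp hA2 u hu v hv
    · have : Sp G A (fun _ => 0) = ∅ := by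
        rw [Finset.eq_empty_iff_forall_notMem]
        rintro ⟨e, f⟩ h
        rw [mem_Sp] at h
        rcases h.2 with ⟨p, q, u, u', _, _, _, _, _, h, _⟩ | ⟨p, q, u, u', _, _, _, _, _, h, _⟩ <;>
        exact absurd h (lt_irrefl _)
      rw [this]
      have : Real.log A.card = 0 := by
        rcases Nat.le_one_iff_eq_zero_or_eq_one.mp hA2 with h | h <;> simp [h]
      rw [this]
      simp
  · have h2 : 2 ≤ A.card := by omega
    have hcR : (2 : ℝ) ≤ A.card := by exact_mod_cast h2
    set Λ := Real.log (3 / 4 * A.card) with hΛ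
    have hΛ0 : 0 ≤ Λ := Real.log_nonneg (by linarith)
    have hΛ1 : Λ ≤ Real.log A.card - 1 / 4 := by
      have h1 : Real.log (A.card : ℝ) = Real.log (4 / 3) + Λ := by
        rw [hΛ, ← Real.log_mul (by norm_num) (by positivity)]
        congr 1; ring
      have h3 := Real.one_sub_inv_le_log_of_pos (show (0 : ℝ) < 4 / 3 by norm_num)
      norm_num at h3
      linarith
    have sub : ∀ B : Finset V, 4 * B.card ≤ 3 * A.card →
        ∃ ρ : V → ℕ, Set.InjOn ρ B ∧ ((Sp G B ρ).card : ℝ) ≤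
          1000000 * Λ * MA G Z B + 30 * (bb G B Bᶜ : ℝ) ^ 2 := by
      intro B hB
      obtain ⟨ρ, h1, h3⟩ := ih B.card (by omega) B rfl
      refine ⟨ρ, h1, h3.trans ?_⟩
      have hl : Real.log B.card ≤ Λ := by
        rcases Nat.eq_zero_or_pos B.card with h | h
        · rw [h]; simpa using hΛ0
        · apply Real.log_le_log (by exact_mod_cast h)
          have : 4 * (B.card : ℝ) ≤ 3 * A.card := by exact_mod_cast hB
          linarith
      have := mul_le_mul_of_nonneg_right hl (MA_nonneg G Z B)
      nlinarith
    have sub2 : ∀ B : Finset V, B ⊆ A →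
        ∃ ρ : V → ℕ, Set.InjOn ρ B ∧ ((Sp G B ρ).card : ℝ) ≤
          1000000 * Λ * MA G Z B + 33 * (bb G B Bᶜ : ℝ) ^ 2 + 192200 * MA G Z B := by
      intro B hB
      obtain ⟨B1, B2, hd, hu, c1, c2, hb, hbd⟩ := cnt_split G Z L A B hB h2
      obtain ⟨ρ1, i1, s1⟩ := sub B1 c1
      obtain ⟨ρ2, i2, s2⟩ := sub B2 c2
      obtain ⟨ρ, i, s⟩ := merge G B1 B2 B hd hu ρ1 ρ2 i1 i2
      refine ⟨ρ, i, ?_⟩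
      have s' : ((Sp G B ρ).card : ℝ) ≤ (Sp G B1 ρ1).card + (Sp G B2 ρ2).card +
        bb G B1 B2 ^ 2 + 2 * (bb G B1 B2 * bb G B Bᶜ) := by exact_mod_cast s
      have hm := mul_le_mul_of_nonneg_left (MA_add G Z hd hu) hΛ0
      nlinarith [sq_nonneg ((bb G B1 B2 : ℝ) - bb G B Bᶜ)]
    obtain ⟨A1, A2, hd, hu, hb, hbd⟩ := ext_split G Z L A
    obtain ⟨ρ1, i1, s1⟩ := sub2 A1 (hu ▸ Finset.subset_union_left)
    obtain ⟨ρ2, i2, s2⟩ := sub2 A2 (hu ▸ Finset.subset_union_right)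
    obtain ⟨ρ, i, s⟩ := merge G A1 A2 A hd hu ρ1 ρ2 i1 i2
    refine ⟨ρ, i, ?_⟩
    have s' : ((Sp G A ρ).card : ℝ) ≤ (Sp G A1 ρ1).card + (Sp G A2 ρ2).card +
      bb G A1 A2 ^ 2 + 2 * (bb G A1 A2 * bb G A Aᶜ) := by exact_mod_cast s
    have hM := MA_nonneg G Z A
    have ha := MA_add G Z hd hu
    have hm := mul_le_mul_of_nonneg_left ha hΛ0
    have hm2 := mul_le_mul_of_nonneg_right hΛ1 hM
    nlinarith [sq_nonneg ((bb G A1 A2 : ℝ) - bb G A Aᶜ), sq_nonneg (bb G A Aᶜ : ℝ)]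

theorem main_order (L : LatSys G.edgeFinset Z N z) :
    ∃ ρ : V → ℕ, Function.Injective ρ ∧ ((Sp G Finset.univ ρ).card : ℝ) ≤
      1000000 * Real.log (Fintype.card V) * MA G Z Finset.univ := by
  obtain ⟨ρ, h1, h2⟩ := main_rec G Z L _ Finset.univ rfl
  refine ⟨ρ, ?_, ?_⟩
  · intro a b h
    exact h1 (by simp) (by simp) h
  · simpa [bb] using h2

end Recur2
section Convex
open MvPolynomial

/-- concurrency determinant of three chords -/
def DD {R : Type*} [CommRing R] (a b c d e f : R) : R :=
  (a + b) * (c * d - e * f) + (c + d) * (e * f - a * b) + (e + f) * (a * b - c * d)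

theorem exists_generic {n : ℕ} : ∃ x : Fin n → ℝ, Function.Injective x ∧
    ∀ a b c d e f : Fin n, [a, b, c, d, e, f].Nodup → DD (x a) (x b) (x c) (x d) (x e) (x f) ≠ 0 := by
  classical
  set S : Set (MvPolynomial (Fin n) ℝ) :=
    Set.range (fun t : Fin n × Fin n × Fin n × Fin n × Fin n × Fin n =>
      DD (X t.1) (X t.2.1) (X t.2.2.1) (X t.2.2.2.1) (X t.2.2.2.2.1) (X t.2.2.2.2.2)) ∪
    Set.range (fun t : Fin n × Fin n => X t.1 - X t.2) with hS
  have hfin : S.Finite := (Set.finite_range _).union (Set.finite_range _)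
  set P : MvPolynomial (Fin n) ℝ := ∏ p ∈ hfin.toFinset.filter (fun p => p ≠ 0), p with hP
  have hP0 : P ≠ 0 := by
    rw [hP, Finset.prod_ne_zero_iff]
    intro p hp
    exact (Finset.mem_filter.mp hp).2
  obtain ⟨x, hx⟩ : ∃ x, eval x P ≠ 0 := by
    by_contra h
    push Not at h
    exact hP0 (MvPolynomial.funext (fun x => by rw [h x]; simp))
  have key : ∀ p ∈ S, p ≠ 0 → eval x p ≠ 0 := by
    intro p hp h0
    rw [hP, map_prod, Finset.prod_ne_zero_iff] at hx
    exact hx p (Finset.mem_filter.mpr ⟨hfin.mem_toFinset.mpr hp, h0⟩)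
  refine ⟨x, ?_, ?_⟩
  · intro i j hij
    by_contra hne
    have := key (X i - X j) (Or.inr ⟨(i, j), rfl⟩) (by
      intro h0
      rw [sub_eq_zero] at h0
      exact hne (X_injective h0))
    apply this
    simp [hij]
  · intro a b c d e f hnd
    have := key (DD (X a) (X b) (X c) (X d) (X e) (X f)) (Or.inl ⟨(a, b, c, d, e, f), rfl⟩) (by
      intro h0
      have h1 := congrArg (eval (fun i => if i = a ∨ i = c ∨ i = d then (1 : ℝ) else 0)) h0
      simp only [List.nodup_cons, List.mem_cons, List.not_mem_nil, or_false, not_or] at hnd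
      obtain ⟨⟨h1', h2, h3, h4, h5⟩, ⟨h6, h7, h8, h9⟩, ⟨h10, h11, h12⟩, ⟨h13, h14⟩, h15, _⟩ := hnd
      simp only [DD, map_add, map_mul, map_sub, eval_X, map_zero] at h1
      simp [Ne.symm h1', h6, h7, Ne.symm h4, Ne.symm h11, Ne.symm h13, Ne.symm h5, Ne.symm h12,
        Ne.symm h14] at h1)
    intro h0
    apply this
    simpa [DD] using h0

theorem exists_pts {n : ℕ} (ρ : Fin n → ℕ) (hρ : Function.Injective ρ) : ∃ x : Fin n → ℝ,
    (∀ i j, x i < x j → ρ i < ρ j) ∧ Function.Injective x ∧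
    ∀ a b c d e f : Fin n, [a, b, c, d, e, f].Nodup → DD (x a) (x b) (x c) (x d) (x e) (x f) ≠ 0 := by
  obtain ⟨x, hx, hD⟩ := exists_generic (n := n)
  set σ := Tuple.sort x
  set τ := Tuple.sort ρ
  have m1 : Monotone (x ∘ σ) := Tuple.monotone_sort x
  have m2 : Monotone (ρ ∘ τ) := Tuple.monotone_sort ρ
  set y : Fin n → ℝ := fun i => x (σ (τ.symm i)) with hy
  have hinj : Function.Injective (fun i => σ (τ.symm i)) := by
    intro i j h; simpa using h
  refine ⟨y, ?_, hx.comp hinj, ?_⟩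
  · intro i j hij
    by_contra hle
    push Not at hle
    have : τ.symm j ≤ τ.symm i := by
      by_contra hlt
      push Not at hlt
      have h := m2 hlt.le
      simp only [Function.comp, Equiv.apply_symm_apply] at h
      have := hρ (le_antisymm h hle)
      rw [this] at hij
      exact lt_irrefl _ hij
    have := m1 this
    exact absurd hij (not_lt.mpr this)
  · intro a b c d e f hnd
    apply hD
    have := hnd.map hinj
    simpa using this

variable {n : ℕ} (G : SimpleGraph (Fin n))

theorem exists_convex (ρ : Fin n → ℕ) (hρ : Function.Injective ρ) [DecidableRel G.Adj] :
    ∃ D : Drawing G, D.numCrossings ≤ (Sp G Finset.univ ρ).card := by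
  classical
  obtain ⟨x, hxρ, hx, hD⟩ := exists_pts ρ hρ
  have hend : ∀ e : G.edgeSet, ∃ u v : Fin n, (e : Sym2 (Fin n)) = s(u, v) ∧ x u < x v := by
    rintro ⟨e, he⟩
    induction e with | _ u v =>
    have hne : u ≠ v := SimpleGraph.Adj.ne he
    rcases lt_or_gt_of_ne (fun h => hne (hx h)) with h | h
    · exact ⟨u, v, rfl, h⟩
    · exact ⟨v, u, Sym2.eq_swap, h⟩
  choose p q hpq hlt using hend
  set cv : G.edgeSet → ℝ → ℝ × ℝ := fun e t =>
    (x (p e) + t * (x (q e) - x (p e)), (x (p e) + t * (x (q e) - x (p e))) * (x (p e) + x (q e)) -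
      x (p e) * x (q e)) with hcv
  have himg : ∀ e P, P ∈ cv e '' Set.Ioo 0 1 → x (p e) < P.1 ∧ P.1 < x (q e) ∧
      P.2 = P.1 * (x (p e) + x (q e)) - x (p e) * x (q e) := by
    rintro e P ⟨t, ⟨h0, h1⟩, rfl⟩
    have := hlt e
    refine ⟨?_, ?_, rfl⟩
    · simp only [hcv]; nlinarith
    · simp only [hcv]; nlinarith
  have himg' : ∀ e P, P ∈ cv e '' Set.Icc 0 1 → 
      P.2 = P.1 * (x (p e) + x (q e)) - x (p e) * x (q e) := by
    rintro e P ⟨t, ⟨h0, h1⟩, rfl⟩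
    rfl
  have heq : ∀ e f, p e = p f → q e = q f → e = f := by
    intro e f h1 h2
    apply Subtype.ext
    rw [hpq e, hpq f, h1, h2]
  have huniq : ∀ e f : G.edgeSet, e ≠ f → ∀ P Q : ℝ × ℝ,
      P.2 = P.1 * (x (p e) + x (q e)) - x (p e) * x (q e) →
      P.2 = P.1 * (x (p f) + x (q f)) - x (p f) * x (q f) →
      Q.2 = Q.1 * (x (p e) + x (q e)) - x (p e) * x (q e) →
      Q.2 = Q.1 * (x (p f) + x (q f)) - x (p f) * x (q f) → P = Q := by
    intro e f hef P Q h1 h2 h3 h4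
    have h5 : (P.1 - Q.1) * ((x (p e) + x (q e)) - (x (p f) + x (q f))) = 0 := by linarith
    rcases mul_eq_zero.mp h5 with h | h
    · have h6 : P.1 = Q.1 := by linarith
      refine Prod.ext h6 ?_
      rw [h1, h3, h6]
    · exfalso
      have hs : x (q e) = x (p f) + x (q f) - x (p e) := by linarith
      have hp : (x (p e) - x (p f)) * (x (p e) - x (q f)) = 0 := by
        rw [hs] at h1
        linarith
      rcases mul_eq_zero.mp hp with h' | h'
      · exact hef (heq e f (hx (by linarith)) (hx (by linarith)))
      · have := hlt e; have := hlt f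
        linarith
  have hcross : ∀ e f : G.edgeSet, e ≠ f → ∀ P : ℝ × ℝ, P ∈ cv e '' Set.Ioo 0 1 →
      P ∈ cv f '' Set.Ioo 0 1 → 
      (x (p e) < x (p f) ∧ x (p f) < x (q e) ∧ x (q e) < x (q f)) ∨
      (x (p f) < x (p e) ∧ x (p e) < x (q f) ∧ x (q f) < x (q e)) := by
    intro e f hef P h1 h2
    obtain ⟨a1, a2, a3⟩ := himg e P h1
    obtain ⟨b1, b2, b3⟩ := himg f P h2
    have hprod : (P.1 - x (p e)) * (x (q e) - P.1) = (P.1 - x (p f)) * (x (q f) - P.1) := by linarith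
    rcases lt_trichotomy (x (p e)) (x (p f)) with h | h | h
    · left
      refine ⟨h, by linarith, ?_⟩
      by_contra hcon
      push Not at hcon
      nlinarith
    · exfalso
      rw [h] at hprod
      have := mul_left_cancel₀ (by linarith) hprod
      exact hef (heq e f (hx h) (hx (by linarith)))
    · right
      refine ⟨h, by linarith, ?_⟩
      by_contra hcon
      push Not at hcon
      nlinarith
  let D : Drawing G := {
    pos := fun v => (x v, x v ^ 2)
    pos_inj := fun u v h => hx (congrArg Prod.fst h)
    curve := cv
    curve_cont := fun e => by
      apply Continuous.continuousOn
      simp only [hcv]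
      fun_prop
    curve_inj := fun e s _ t _ h => by
      have h1 := congrArg Prod.fst h
      simp only [hcv] at h1
      have := hlt e
      exact mul_right_cancel₀ (sub_ne_zero.mpr this.ne') (add_left_cancel h1)
    curve_ends := fun e => ⟨p e, q e, hpq e, by
      simp only [hcv, Prod.mk.injEq]; constructor <;> ring, by
      simp only [hcv, Prod.mk.injEq]; constructor <;> ring⟩
    curve_avoid := by
      rintro e t ht ⟨w, hw⟩
      obtain ⟨h1, h2, h3⟩ := himg e (cv e t) ⟨t, ht, rfl⟩
      rw [← hw] at h1 h2 h3
      simp only at h1 h2 h3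
      have : (x w - x (p e)) * (x (q e) - x w) = 0 := by linarith
      have := mul_pos (sub_pos.2 h1) (sub_pos.2 h2)
      linarith
    curve_finite_inter := fun e f hef => by
      apply Set.Subsingleton.finite
      rintro P ⟨h1, h2⟩ Q ⟨h3, h4⟩
      exact huniq e f hef P Q (himg' e P h1) (himg' f P h2) (himg' e Q h3) (himg' f Q h4)
    no_triple_point := by
      rintro e f g hef hfg heg P ⟨h1, h2, h3⟩
      have c1 := hcross e f hef P h1 h2
      have c2 := hcross f g hfg P h2 h3
      have c3 := hcross e g heg P h1 h3
      obtain ⟨a1, a2, a3⟩ := himg e P h1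
      obtain ⟨b1, b2, b3⟩ := himg f P h2
      obtain ⟨d1, d2, d3⟩ := himg g P h3
      have ne : ∀ u v, x u ≠ x v → u ≠ v := fun u v h h' => h (by rw [h'])
      apply hD (p e) (q e) (p f) (q f) (p g) (q g)
      · simp only [List.nodup_cons, List.mem_cons, List.not_mem_nil, or_false, not_or]
        refine ⟨⟨ne _ _ ?_, ne _ _ ?_, ne _ _ ?_, ne _ _ ?_, ne _ _ ?_⟩,
          ⟨ne _ _ ?_, ne _ _ ?_, ne _ _ ?_, ne _ _ ?_⟩, ⟨ne _ _ ?_, ne _ _ ?_, ne _ _ ?_⟩,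
          ⟨ne _ _ ?_, ne _ _ ?_⟩, ne _ _ ?_, ?_, ?_⟩
        any_goals first
          | exact (by linarith : _ < _).ne
          | exact (by linarith : _ > _).ne'
          | (rcases c1 with c | c <;> first | exact (by linarith : _ < _).ne | exact (by linarith : _ > _).ne')
          | (rcases c2 with c | c <;> first | exact (by linarith : _ < _).ne | exact (by linarith : _ > _).ne')
          | (rcases c3 with c | c <;> first | exact (by linarith : _ < _).ne | exact (by linarith : _ > _).ne')
        all_goals simp
      · unfold DD
        have e1 : x (p e) * x (q e) = P.1 * (x (p e) + x (q e)) - P.2 := by linarith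
        have e2 : x (p f) * x (q f) = P.1 * (x (p f) + x (q f)) - P.2 := by linarith
        have e3 : x (p g) * x (q g) = P.1 * (x (p g) + x (q g)) - P.2 := by linarith
        rw [e1, e2, e3]; ring }
  have hSp : ∀ e f : G.edgeSet, e ≠ f → ∀ P, P ∈ cv e '' Set.Ioo 0 1 → P ∈ cv f '' Set.Ioo 0 1 →
      ((e : Sym2 (Fin n)), (f : Sym2 (Fin n))) ∈ Sp G Finset.univ ρ := by
    intro e f hef P h1 h2
    rw [mem_Sp]
    refine ⟨⟨SimpleGraph.mem_edgeFinset.mpr e.2, SimpleGraph.mem_edgeFinset.mpr f.2⟩, ?_⟩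
    rcases hcross e f hef P h1 h2 with ⟨c1, c2, c3⟩ | ⟨c1, c2, c3⟩
    · right
      exact ⟨p e, q e, p f, q f, hpq e, hpq f, by simp, by simp, by simp, hxρ _ _ c1, hxρ _ _ c2,
        fun _ => Or.inr (hxρ _ _ c3)⟩
    · left
      exact ⟨p f, q f, p e, q e, hpq f, hpq e, by simp, by simp, by simp, hxρ _ _ c1, hxρ _ _ c2,
        fun _ => Or.inr (hxρ _ _ c3)⟩
  refine ⟨D, ?_⟩
  unfold Drawing.numCrossings
  rw [← Set.ncard_coe_finset]
  have hout : ∀ y ∈ D.crossings, ∃ e f : G.edgeSet, e ≠ f ∧ y.1 = s(e, f) ∧ Quot.out y.1 = (e, f) ∧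
      D.IsCross e f y.2 := by
    rintro ⟨w, P⟩ ⟨e, f, hef, rfl, h1, h2⟩
    have h3 : s((Quot.out s(e, f)).1, (Quot.out s(e, f)).2) = s(e, f) := Quot.out_eq s(e, f)
    rcases Sym2.eq_iff.mp h3 with ⟨h4, h5⟩ | ⟨h4, h5⟩
    · exact ⟨e, f, hef, rfl, Prod.ext h4 h5, h1, h2⟩
    · exact ⟨f, e, hef.symm, Sym2.eq_swap, Prod.ext h4 h5, h2, h1⟩
  apply Set.ncard_le_ncard_of_injOn (fun y => (((Quot.out y.1).1 : Sym2 (Fin n)),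
    ((Quot.out y.1).2 : Sym2 (Fin n))))
  · intro y hy
    obtain ⟨e, f, hef, h1, h2, h3⟩ := hout y hy
    simp only [h2]
    exact hSp e f hef y.2 h3.1 h3.2
  · intro y hy y' hy' heq'
    obtain ⟨e, f, hef, h1, h2, h3⟩ := hout y hy
    obtain ⟨e', f', hef', h1', h2', h3'⟩ := hout y' hy'
    simp only [h2, h2', Prod.mk.injEq] at heq'
    have q1 : e = e' := Subtype.ext heq'.1
    have q2 : f = f' := Subtype.ext heq'.2
    subst q1 q2
    refine Prod.ext (h1.trans h1'.symm) ?_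
    exact huniq e f hef _ _ (himg e _ h3.1).2.2 (himg f _ h3.2).2.2 (himg e _ h3'.1).2.2
      (himg f _ h3'.2).2.2

end Convex
section Lattice
open Filter Topology

def Zs (a b : ℝ → ℝ) (δ : ℝ) : Set (ℕ × ℕ) :=
  {P | ∃ t ∈ Set.Icc (0 : ℝ) 1, ∃ t' ∈ Set.Icc (0 : ℝ) 1, |t - t'| < δ ∧ P = (⌊a t⌋₊, ⌊b t'⌋₊)}

theorem floor_near {x y : ℝ} (hx : 0 ≤ x) (hy : 0 ≤ y) (h : |x - y| < 1) :
    ⌊x⌋₊ ≤ ⌊y⌋₊ + 1 ∧ ⌊y⌋₊ ≤ ⌊x⌋₊ + 1 := by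
  rw [abs_lt] at h
  have h1 := Nat.floor_le hx
  have h2 := Nat.floor_le hy
  have h3 := Nat.lt_floor_add_one x
  have h4 := Nat.lt_floor_add_one y
  constructor
  · have : (⌊x⌋₊ : ℝ) < ⌊y⌋₊ + 2 := by linarith
    have : ⌊x⌋₊ < ⌊y⌋₊ + 2 := by exact_mod_cast this
    omega
  · have : (⌊y⌋₊ : ℝ) < ⌊x⌋₊ + 2 := by linarith
    have : ⌊y⌋₊ < ⌊x⌋₊ + 2 := by exact_mod_cast this
    omega

theorem Zs_conn (a b : ℝ → ℝ) (δ : ℝ) (hδ : 0 < δ) (ha0 : ∀ t ∈ Set.Icc (0 : ℝ) 1, 0 ≤ a t)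
    (hb0 : ∀ t ∈ Set.Icc (0 : ℝ) 1, 0 ≤ b t)
    (ha : ∀ t ∈ Set.Icc (0 : ℝ) 1, ∀ t' ∈ Set.Icc (0 : ℝ) 1, |t - t'| < δ → |a t - a t'| < 1)
    (hb : ∀ t ∈ Set.Icc (0 : ℝ) 1, ∀ t' ∈ Set.Icc (0 : ℝ) 1, |t - t'| < δ → |b t - b t'| < 1) :
    ∀ p ∈ Zs a b δ, ∀ q ∈ Zs a b δ,
      Relation.ReflTransGen (fun x y => LAdj x y ∧ x ∈ Zs a b δ ∧ y ∈ Zs a b δ) p q := by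
  set R : ℕ × ℕ → ℕ × ℕ → Prop := fun x y => LAdj x y ∧ x ∈ Zs a b δ ∧ y ∈ Zs a b δ with hR
  have hsym : ∀ x y, Relation.ReflTransGen R x y → Relation.ReflTransGen R y x := by
    intro x y h
    induction h with
    | refl => exact .refl
    | tail _ hs ih => exact Relation.ReflTransGen.head ⟨hs.1.symm, hs.2.2, hs.2.1⟩ ih
  have st1 : ∀ x y c, x ≤ y + 1 → y ≤ x + 1 → (x, c) ∈ Zs a b δ → (y, c) ∈ Zs a b δ →
      Relation.ReflTransGen R (x, c) (y, c) := by
    intro x y c h1 h2 m1 m2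
    by_cases he : x = y
    · rw [he]
    · refine .single ⟨?_, m1, m2⟩
      have : y = x + 1 ∨ x = y + 1 := by omega
      rcases this with h | h
      · exact Or.inl ⟨h, rfl⟩
      · exact Or.inr (Or.inl ⟨h, rfl⟩)
  have st2 : ∀ x y c, x ≤ y + 1 → y ≤ x + 1 → (c, x) ∈ Zs a b δ → (c, y) ∈ Zs a b δ →
      Relation.ReflTransGen R (c, x) (c, y) := by
    intro x y c h1 h2 m1 m2
    by_cases he : x = y
    · rw [he]
    · refine .single ⟨?_, m1, m2⟩
      have : y = x + 1 ∨ x = y + 1 := by omega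
      rcases this with h | h
      · exact Or.inr (Or.inr (Or.inl ⟨rfl, h⟩))
      · exact Or.inr (Or.inr (Or.inr ⟨rfl, h⟩))
  have s1 : ∀ t ∈ Set.Icc (0 : ℝ) 1, ∀ t' ∈ Set.Icc (0 : ℝ) 1, |t - t'| < δ →
      Relation.ReflTransGen R (⌊a t⌋₊, ⌊b t'⌋₊) (⌊a t'⌋₊, ⌊b t'⌋₊) := by
    intro t ht t' ht' h
    have := floor_near (ha0 t ht) (ha0 t' ht') (ha t ht t' ht' h)
    exact st1 _ _ _ this.1 this.2 ⟨t, ht, t', ht', h, rfl⟩ ⟨t', ht', t', ht', by simpa using hδ, rfl⟩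
  have s2 : ∀ t ∈ Set.Icc (0 : ℝ) 1, ∀ t' ∈ Set.Icc (0 : ℝ) 1, |t - t'| < δ →
      Relation.ReflTransGen R (⌊a t⌋₊, ⌊b t⌋₊) (⌊a t'⌋₊, ⌊b t'⌋₊) := by
    intro t ht t' ht' h
    have := floor_near (hb0 t ht) (hb0 t' ht') (hb t ht t' ht' h)
    exact (st2 _ _ _ this.1 this.2 ⟨t, ht, t, ht, by simpa using hδ, rfl⟩
      ⟨t, ht, t', ht', h, rfl⟩).trans (s1 t ht t' ht' h)
  obtain ⟨m, hm⟩ := exists_nat_one_div_lt hδ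
  have hmp : (0 : ℝ) < m + 1 := by positivity
  have s3 : ∀ t ∈ Set.Icc (0 : ℝ) 1,
      Relation.ReflTransGen R (⌊a 0⌋₊, ⌊b 0⌋₊) (⌊a t⌋₊, ⌊b t⌋₊) := by
    intro t ht
    have hi : ∀ i : ℕ, i ≤ m + 1 → t * (i / (m + 1)) ∈ Set.Icc (0 : ℝ) 1 := by
      intro i hi
      have h1 : (i : ℝ) / (m + 1) ≤ 1 := by
        rw [div_le_one hmp]; exact_mod_cast hi
      have h0 : 0 ≤ (i : ℝ) / (m + 1) := by positivity
      exact ⟨mul_nonneg ht.1 h0, by nlinarith [ht.1, ht.2]⟩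
    have : ∀ i : ℕ, i ≤ m + 1 → Relation.ReflTransGen R (⌊a 0⌋₊, ⌊b 0⌋₊)
        (⌊a (t * (i / (m + 1)))⌋₊, ⌊b (t * (i / (m + 1)))⌋₊) := by
      intro i
      induction i with
      | zero => intro _; simp; exact .refl
      | succ i ih =>
        intro hi'
        refine (ih (by omega)).trans (s2 _ (hi i (by omega)) _ (hi _ hi') ?_)
        have : t * ((i : ℝ) / (m + 1)) - t * (((i + 1 : ℕ) : ℝ) / (m + 1)) = -(t * (1 / (m + 1))) := by
          push_cast; ring
        rw [this, abs_neg, abs_of_nonneg (mul_nonneg ht.1 (by positivity))]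
        have : 0 < 1 / ((m : ℝ) + 1) := by positivity
        nlinarith [ht.1, ht.2]
    have h := this (m + 1) le_rfl
    have e : ((m + 1 : ℕ) : ℝ) / (m + 1) = 1 := by
      push_cast; exact div_self hmp.ne'
    rw [e, mul_one] at h
    exact h
  have s4 : ∀ p ∈ Zs a b δ, Relation.ReflTransGen R (⌊a 0⌋₊, ⌊b 0⌋₊) p := by
    rintro p ⟨t, ht, t', ht', h, rfl⟩
    exact (s3 t' ht').trans (hsym _ _ (s1 t ht t' ht' h))
  intro p hp q hq
  exact (hsym _ _ (s4 p hp)).trans (s4 q hq)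

variable {n : ℕ} {G : SimpleGraph (Fin n)}

theorem floor_abs {x y : ℝ} (hx : 0 ≤ x) (hy : 0 ≤ y) (h : ⌊x⌋₊ = ⌊y⌋₊) : |x - y| < 1 := by
  have h1 := Nat.floor_le hx
  have h2 := Nat.floor_le hy
  have h3 := Nat.lt_floor_add_one x
  have h4 := Nat.lt_floor_add_one y
  rw [h] at h1 h3
  rw [abs_lt]; constructor <;> linarith

theorem lattice (D : Drawing G) [DecidableRel G.Adj] : ∃ (Z : Sym2 (Fin n) → Set (ℕ × ℕ)) (N : ℕ) 
    (z : Fin n → ℕ × ℕ), LatSys G.edgeFinset Z N z ∧ ∀ e f : G.edgeSet, (Z e ∩ Z f).Nonempty →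
      ∃ t ∈ Set.Icc (0 : ℝ) 1, ∃ s ∈ Set.Icc (0 : ℝ) 1, D.curve e t = D.curve f s := by
  classical
  have hK : ∀ e, IsCompact (D.curve e '' Set.Icc 0 1) := fun e =>
    isCompact_Icc.image_of_continuousOn (D.curve_cont e)
  -- bound
  obtain ⟨B, hB⟩ : ∃ B : ℝ, ∀ e, ∀ t ∈ Set.Icc (0 : ℝ) 1, ‖D.curve e t‖ ≤ B := by
    have : IsCompact (⋃ e, D.curve e '' Set.Icc 0 1) := isCompact_iUnion hK
    obtain ⟨B, hB⟩ := this.isBounded.exists_norm_le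
    exact ⟨B, fun e t ht => hB _ (Set.mem_iUnion.mpr ⟨e, t, ht, rfl⟩)⟩
  -- separation
  obtain ⟨k, hk, hk0⟩ : ∃ k : ℕ, (∀ ef : G.edgeSet × G.edgeSet,
      Disjoint (D.curve ef.1 '' Set.Icc 0 1) (D.curve ef.2 '' Set.Icc 0 1) →
      ∀ t ∈ Set.Icc (0 : ℝ) 1, ∀ s ∈ Set.Icc (0 : ℝ) 1,
        4 ≤ k * dist (D.curve ef.1 t) (D.curve ef.2 s)) ∧ 0 < k := by
    apply Eventually.exists (f := atTop)
    refine Eventually.and ?_ (eventually_gt_atTop 0)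
    rw [eventually_all]
    rintro ⟨e, f⟩
    by_cases hd : Disjoint (D.curve e '' Set.Icc 0 1) (D.curve f '' Set.Icc 0 1)
    · obtain ⟨m, hm, hmin⟩ := ((hK e).prod (hK f)).exists_isMinOn
        (⟨(D.curve e 0, D.curve f 0), ⟨⟨0, by simp, rfl⟩, ⟨0, by simp, rfl⟩⟩⟩ :
          ((D.curve e '' Set.Icc 0 1) ×ˢ (D.curve f '' Set.Icc 0 1)).Nonempty)
        (f := fun x : (ℝ × ℝ) × (ℝ × ℝ) => dist x.1 x.2) (by fun_prop)
      have hpos : 0 < dist m.1 m.2 := by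
        rw [dist_pos]
        intro h
        exact Set.disjoint_left.mp hd hm.1 (h ▸ hm.2)
      obtain ⟨k0, hk0⟩ := exists_nat_gt (4 / dist m.1 m.2)
      filter_upwards [eventually_ge_atTop k0] with k hk _ t ht s hs
      have h1 : dist m.1 m.2 ≤ dist (D.curve e t) (D.curve f s) :=
        hmin (a := (D.curve e t, D.curve f s)) ⟨⟨t, ht, rfl⟩, ⟨s, hs, rfl⟩⟩
      rw [div_lt_iff₀ hpos] at hk0
      have h2 : (k0 : ℝ) ≤ k := by exact_mod_cast hk
      calc (4 : ℝ) ≤ k0 * dist m.1 m.2 := hk0.le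
        _ ≤ _ := by gcongr
    · exact Eventually.of_forall fun k h => absurd h hd
  have hkR : (0 : ℝ) < k := by exact_mod_cast hk0
  obtain ⟨δ, hδ, hδ0⟩ : ∃ δ : ℝ, (∀ e : G.edgeSet, ∀ t ∈ Set.Icc (0 : ℝ) 1,
      ∀ s ∈ Set.Icc (0 : ℝ) 1, |t - s| < δ → k * dist (D.curve e t) (D.curve e s) < 1) ∧ 0 < δ := by
    apply Eventually.exists (f := 𝓝[>] (0 : ℝ))
    refine Eventually.and ?_ self_mem_nhdsWithin
    rw [eventually_all]
    intro e
    have hu := isCompact_Icc.uniformContinuousOn_of_continuous (D.curve_cont e)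
    rw [Metric.uniformContinuousOn_iff] at hu
    obtain ⟨δ0, h0, h⟩ := hu (1 / k) (by positivity)
    filter_upwards [Ioo_mem_nhdsGT h0] with δ hδ t ht s hs hts
    have := h t ht s hs (by rw [Real.dist_eq]; exact hts.trans hδ.2)
    rw [lt_div_iff₀ hkR] at this
    linarith
  set g1 : ℝ × ℝ → ℝ := fun x => k * (x.1 + B) + 1 with hg1
  set g2 : ℝ × ℝ → ℝ := fun x => k * (x.2 + B) + 1 with hg2
  have hd1 : ∀ x y : ℝ × ℝ, |g1 x - g1 y| ≤ k * dist x y := by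
    intro x y
    have : g1 x - g1 y = k * (x.1 - y.1) := by simp only [hg1]; ring
    rw [this, abs_mul, abs_of_pos hkR]
    gcongr
    rw [Prod.dist_eq, ← Real.dist_eq]; exact le_max_left _ _
  have hd2 : ∀ x y : ℝ × ℝ, |g2 x - g2 y| ≤ k * dist x y := by
    intro x y
    have : g2 x - g2 y = k * (x.2 - y.2) := by simp only [hg2]; ring
    rw [this, abs_mul, abs_of_pos hkR]
    gcongr
    rw [Prod.dist_eq, ← Real.dist_eq]; exact le_max_right _ _
  have hg : ∀ e, ∀ t ∈ Set.Icc (0 : ℝ) 1, (1 ≤ g1 (D.curve e t) ∧ g1 (D.curve e t) ≤ k * (2 * B) + 1) ∧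
      (1 ≤ g2 (D.curve e t) ∧ g2 (D.curve e t) ≤ k * (2 * B) + 1) := by
    intro e t ht
    have h := hB e t ht
    have h1 := (norm_fst_le (D.curve e t)).trans h
    have h2 := (norm_snd_le (D.curve e t)).trans h
    rw [Real.norm_eq_abs, abs_le] at h1 h2
    simp only [hg1, hg2]
    refine ⟨⟨?_, ?_⟩, ?_, ?_⟩ <;> nlinarith
  set Z : Sym2 (Fin n) → Set (ℕ × ℕ) := fun e => if h : e ∈ G.edgeSet then
    Zs (fun t => g1 (D.curve ⟨e, h⟩ t)) (fun t => g2 (D.curve ⟨e, h⟩ t)) δ else ∅ with hZ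
  have hZe : ∀ e : G.edgeSet, Z e = 
      Zs (fun t => g1 (D.curve e t)) (fun t => g2 (D.curve e t)) δ := by
    intro e
    simp only [hZ, e.2, dif_pos]
  refine ⟨Z, ⌊(k : ℝ) * (2 * B) + 1⌋₊ + 1, fun v => (⌊g1 (D.pos v)⌋₊, ⌊g2 (D.pos v)⌋₊), ?_, ?_⟩
  · refine ⟨?_, ?_, ?_⟩
    · intro e he p hp
      rw [SimpleGraph.mem_edgeFinset] at he
      have := hZe ⟨e, he⟩
      rw [this] at hp
      obtain ⟨t, ht, t', ht', _, rfl⟩ := hp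
      have a1 := (hg ⟨e, he⟩ t ht).1
      have a2 := (hg ⟨e, he⟩ t' ht').2
      refine ⟨Nat.floor_pos.mpr a1.1, Nat.lt_succ_of_le (Nat.floor_le_floor a1.2),
        Nat.floor_pos.mpr a2.1, Nat.lt_succ_of_le (Nat.floor_le_floor a2.2)⟩
    · intro e he
      rw [SimpleGraph.mem_edgeFinset] at he
      have := hZe ⟨e, he⟩
      simp only at this
      rw [this]
      apply Zs_conn _ _ δ hδ0
      · intro t ht; linarith [(hg ⟨e, he⟩ t ht).1.1]
      · intro t ht; linarith [(hg ⟨e, he⟩ t ht).2.1]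
      · intro t ht t' ht' h
        exact (hd1 _ _).trans_lt (hδ _ t ht t' ht' h)
      · intro t ht t' ht' h
        exact (hd2 _ _).trans_lt (hδ _ t ht t' ht' h)
    · intro e he v hv
      rw [SimpleGraph.mem_edgeFinset] at he
      have := hZe ⟨e, he⟩
      simp only at this
      rw [this]
      obtain ⟨u, w, h1, h2, h3⟩ := D.curve_ends ⟨e, he⟩
      simp only at h1
      rw [h1, Sym2.mem_iff] at hv
      rcases hv with rfl | rfl
      · exact ⟨0, by simp, 0, by simp, by simpa using hδ0, by simp only [h2]⟩
      · exact ⟨1, by simp, 1, by simp, by simpa using hδ0, by simp only [h3]⟩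
  · rintro e f ⟨P, hPe, hPf⟩
    rw [hZe] at hPe hPf
    obtain ⟨t, ht, t', ht', htt, rfl⟩ := hPe
    obtain ⟨s, hs, s', hs', hss, heq⟩ := hPf
    simp only [Prod.mk.injEq] at heq
    by_contra hcon
    push Not at hcon
    have hdis : Disjoint (D.curve e '' Set.Icc 0 1) (D.curve f '' Set.Icc 0 1) := by
      rw [Set.disjoint_left]
      rintro x ⟨t, ht, rfl⟩ ⟨s, hs, h⟩
      exact hcon t ht s hs h.symm
    have h4 := hk (e, f) hdis t ht s hs
    simp only at h4
    have b1 := floor_abs (by linarith [(hg e t ht).1.1]) (by linarith [(hg f s hs).1.1]) heq.1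
    have b2 := floor_abs (by linarith [(hg e t' ht').2.1]) (by linarith [(hg f s' hs').2.1]) heq.2
    have b3 := (hd2 _ _).trans_lt (hδ e t ht t' ht' htt)
    have b4 := (hd2 _ _).trans_lt (hδ f s hs s' hs' hss)
    have e1 : k * dist (D.curve e t) (D.curve f s) = max |g1 (D.curve e t) - g1 (D.curve f s)|
        |g2 (D.curve e t) - g2 (D.curve f s)| := by
      have i1 : g1 (D.curve e t) - g1 (D.curve f s) = k * ((D.curve e t).1 - (D.curve f s).1) := by
        simp only [hg1]; ring
      have i2 : g2 (D.curve e t) - g2 (D.curve f s) = k * ((D.curve e t).2 - (D.curve f s).2) := by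
        simp only [hg2]; ring
      rw [i1, i2, abs_mul, abs_mul, abs_of_pos hkR, Prod.dist_eq, Real.dist_eq, Real.dist_eq,
        mul_max_of_nonneg _ _ hkR.le]
    rw [e1] at h4
    rw [abs_lt] at b2 b3 b4
    rcases le_max_iff.mp h4 with h | h
    · linarith
    · rcases le_abs.mp h with h | h <;> linarith

theorem mA_le (D : Drawing G) [DecidableRel G.Adj] (Z : Sym2 (Fin n) → Set (ℕ × ℕ))
    (hZ : ∀ e f : G.edgeSet, (Z e ∩ Z f).Nonempty →
      ∃ t ∈ Set.Icc (0 : ℝ) 1, ∃ s ∈ Set.Icc (0 : ℝ) 1, D.curve e t = D.curve f s) :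
    mA G Z Finset.univ ≤ ∑ v, G.degree v ^ 2 + 2 * D.numCrossingPairs := by
  classical
  have hend : ∀ (e : G.edgeSet) (t : ℝ), t ∈ Set.Icc (0 : ℝ) 1 → t ∉ Set.Ioo (0 : ℝ) 1 →
      ∃ u ∈ (e : Sym2 (Fin n)), D.curve e t = D.pos u := by
    intro e t ht hn
    obtain ⟨u, w, h1, h2, h3⟩ := D.curve_ends e
    have : t = 0 ∨ t = 1 := by
      by_contra hc
      push Not at hc
      exact hn ⟨lt_of_le_of_ne ht.1 (Ne.symm hc.1), lt_of_le_of_ne ht.2 hc.2⟩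
    rcases this with rfl | rfl
    · exact ⟨u, by rw [h1]; simp, h2⟩
    · exact ⟨w, by rw [h1]; simp, h3⟩
  have hcl : ∀ e f : G.edgeSet, (Z e ∩ Z f).Nonempty →
      (∃ v, v ∈ (e : Sym2 (Fin n)) ∧ v ∈ (f : Sym2 (Fin n))) ∨ s(e, f) ∈ D.crossingPairs := by
    intro e f h
    by_cases hef : e = f
    · left
      obtain ⟨u, w, h1, _⟩ := D.curve_ends e
      exact ⟨u, by rw [h1]; simp, by rw [← hef, h1]; simp⟩
    obtain ⟨t, ht, s, hs, heq⟩ := hZ e f h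
    by_cases ht' : t ∈ Set.Ioo (0 : ℝ) 1
    · by_cases hs' : s ∈ Set.Ioo (0 : ℝ) 1
      · right
        exact ⟨e, f, hef, rfl, D.curve e t, ⟨t, ht', rfl⟩, ⟨s, hs', heq.symm⟩⟩
      · obtain ⟨u, _, hu⟩ := hend f s hs hs'
        exact absurd ⟨u, by rw [heq, hu]⟩ (D.curve_avoid e t ht')
    · obtain ⟨u, hue, hu⟩ := hend e t ht ht'
      by_cases hs' : s ∈ Set.Ioo (0 : ℝ) 1
      · exact absurd ⟨u, by rw [← heq, hu]⟩ (D.curve_avoid f s hs')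
      · obtain ⟨w, hwf, hw⟩ := hend f s hs hs'
        have : u = w := D.pos_inj (by rw [← hu, ← hw, heq])
        subst this
        exact Or.inl ⟨u, hue, hwf⟩
  have hfin : D.crossingPairs.Finite := Set.toFinite _
  set CP := hfin.toFinset with hCP
  set va : G.edgeSet × G.edgeSet → Sym2 (Fin n) × Sym2 (Fin n) := fun x => (x.1, x.2) with hva
  set S : Finset (Sym2 (Fin n) × Sym2 (Fin n)) :=
    (Finset.univ.biUnion fun v => G.incidenceFinset v ×ˢ G.incidenceFinset v) ∪
      (CP.image (fun q => va (Quot.out q)) ∪ CP.image (fun q => va (Quot.out q).swap)) with hS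
  have hS1 : S.card ≤ ∑ v, G.degree v ^ 2 + 2 * D.numCrossingPairs := by
    have e1 : (Finset.univ.biUnion fun v => G.incidenceFinset v ×ˢ G.incidenceFinset v).card ≤
        ∑ v, G.degree v ^ 2 := by
      refine Finset.card_biUnion_le.trans (le_of_eq (Finset.sum_congr rfl fun v _ => ?_))
      rw [Finset.card_product, SimpleGraph.card_incidenceFinset_eq_degree, pow_two]
    have e2 : CP.card = D.numCrossingPairs := by
      rw [hCP, Drawing.numCrossingPairs, Set.ncard_eq_toFinset_card _ hfin]
    have e3 : (CP.image (fun q => va (Quot.out q))).card ≤ CP.card := Finset.card_image_le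
    have e4 : (CP.image (fun q => va (Quot.out q).swap)).card ≤ CP.card := Finset.card_image_le
    have e5 := Finset.card_union_le (CP.image (fun q => va (Quot.out q)))
      (CP.image (fun q => va (Quot.out q).swap))
    refine (Finset.card_union_le _ _).trans ?_
    omega
  refine le_trans ?_ hS1
  unfold mA
  rw [← Finset.card_sigma]
  apply Finset.card_le_card_of_injOn (fun x => (x.1, x.2))
  · rintro ⟨e, f⟩ h
    simp only [Finset.coe_sigma, Set.mem_sigma_iff, Finset.mem_coe, strN, Finset.mem_filter] at h
    obtain ⟨he, hf, hne⟩ := h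
    have he' := SimpleGraph.mem_edgeFinset.mp (FA_sub G _ he)
    have hf' := SimpleGraph.mem_edgeFinset.mp (FA_sub G _ hf)
    simp only [Finset.mem_coe, hS, Finset.mem_union]
    rcases hcl ⟨e, he'⟩ ⟨f, hf'⟩ hne with ⟨v, h1, h2⟩ | h
    · left
      simp only [Finset.mem_biUnion, Finset.mem_univ, true_and, Finset.mem_product,
        SimpleGraph.mem_incidenceFinset]
      exact ⟨v, ⟨he', h1⟩, ⟨hf', h2⟩⟩
    · right
      have h3 : ∀ q : Sym2 G.edgeSet, s((Quot.out q).1, (Quot.out q).2) = q := fun q => Quot.out_eq q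
      simp only [Finset.mem_image]
      rcases Sym2.eq_iff.mp (h3 s(⟨e, he'⟩, ⟨f, hf'⟩)) with ⟨h4, h5⟩ | ⟨h4, h5⟩
      · left
        refine ⟨_, hfin.mem_toFinset.mpr h, ?_⟩
        simp only [hva, h4, h5]
      · right
        refine ⟨_, hfin.mem_toFinset.mpr h, ?_⟩
        simp only [hva, Prod.fst_swap, Prod.snd_swap, h4, h5]
  · rintro ⟨e, f⟩ _ ⟨e', f'⟩ _ h
    simp only [Prod.mk.injEq] at h
    rw [h.1, h.2]

end Lattice

theorem cr_le_log_mul_pcr_ssqd :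
    ∃ c : ℝ, 0 < c ∧ ∀ (n : ℕ) (G : SimpleGraph (Fin n)), 2 ≤ n →
      (crNum G : ℝ) ≤ c * Real.log n * ((pcrNum G : ℝ) + (ssqd G : ℝ)) := by
  classical
  refine ⟨2000000, by norm_num, ?_⟩
  intro n G hn
  obtain ⟨D0, _⟩ := exists_convex G (fun i => (i : ℕ)) Fin.val_injective
  obtain ⟨D, hD⟩ : ∃ D : Drawing G, D.numCrossingPairs = pcrNum G :=
    Nat.sInf_mem (s := { n | ∃ D : Drawing G, D.numCrossingPairs = n }) ⟨_, D0, rfl⟩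
  obtain ⟨Z, N, z, L, hZ⟩ := lattice D
  have hm := mA_le D Z hZ
  obtain ⟨ρ, hρ, hcard⟩ := main_order G Z L
  obtain ⟨D1, hD1⟩ := exists_convex G ρ hρ
  have hcr : crNum G ≤ (Sp G Finset.univ ρ).card :=
    (Nat.sInf_le (s := { n | ∃ D : Drawing G, D.numCrossings = n }) ⟨D1, rfl⟩).trans hD1
  have hss : ssqd G = ∑ v, G.degree v ^ 2 := by
    rw [ssqd, finsum_eq_sum_of_fintype]
    refine Finset.sum_congr rfl fun v _ => ?_
    rw [Set.ncard_eq_toFinset_card', ← SimpleGraph.card_neighborFinset_eq_degree]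
    rfl
  rw [hD, ← hss] at hm
  have hm' : (mA G Z Finset.univ : ℝ) ≤ ssqd G + 2 * pcrNum G := by exact_mod_cast hm
  have hM : MA G Z Finset.univ ≤ 2 * ((pcrNum G : ℝ) + ssqd G) := by
    have : (ssqd G : ℝ) = ∑ v, (G.degree v : ℝ) ^ 2 := by rw [hss]; push_cast; rfl
    unfold MA
    rw [← this]; linarith
  have hl : 0 ≤ Real.log n := Real.log_nonneg (by exact_mod_cast (by omega : 1 ≤ n))
  rw [Fintype.card_fin] at hcard
  have hcr' : (crNum G : ℝ) ≤ (Sp G Finset.univ ρ).card := by exact_mod_cast hcr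
  have := mul_le_mul_of_nonneg_left hM hl
  linarith
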